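/- arXiv:2111.08471 — 7 statements merged into one kernel-verified Lean document; each statement's English description precedes it below -/
import Mathlib

section
/- Let G be a strongly connected weighted digraph on N nodes with Laplacian L. Then there exists a vector r = (r_1,…,r_N)ᵀ ∈ ℝ^N with r_i > 0 for all i, rᵀL = 0ᵀ, and Σ_{i=1}^N r_i = 1 (a normalized positive left eigenvector of L associated with the eigenvalue zero). -/
open Matrix Finset

/-- The Laplacian matrix of a weighted digraph with adjacency weights `a`. -/
def graphLaplacian {N : ℕ} (a : Fin N → Fin N → ℝ) : Matrix (Fin N) (Fin N) ℝ :=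
  Matrix.of fun i j => if i = j then ∑ k, a i k else -(a i j)

/-- `(j,i)` is an edge iff `a i j > 0`; a directed path from `i` to `j` exists iff
`Relation.TransGen` of the edge relation holds.  Strong connectivity. -/
def StronglyConnected {N : ℕ} (a : Fin N → Fin N → ℝ) : Prop :=
  ∀ i j : Fin N, i ≠ j → Relation.TransGen (fun u v : Fin N => 0 < a v u) i j

theorem vecMul_graphLaplacian_apply {N : ℕ} {a : Fin N → Fin N → ℝ} (ha_diag : ∀ i, a i i = 0)
    (r : Fin N → ℝ) (j : Fin N) :
    Matrix.vecMul r (graphLaplacian a) j = r j * ∑ k, a j k - ∑ i, r i * a i j := by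
  have h (i : Fin N) : r i * graphLaplacian a i j =
      (if i = j then r j * ∑ k, a j k else 0) - r i * a i j := by
    by_cases hij : i = j
    · subst hij; simp [graphLaplacian, ha_diag]
    · simp [graphLaplacian, hij]
  simp only [Matrix.vecMul, dotProduct, h, Finset.sum_sub_distrib]
  simp

theorem graphLaplacian_mulVec_one {N : ℕ} {a : Fin N → Fin N → ℝ} (ha_diag : ∀ i, a i i = 0) :
    graphLaplacian a *ᵥ 1 = 0 := by
  funext i
  have h (j : Fin N) : graphLaplacian a i j = (if i = j then ∑ k, a i k else 0) - a i j := by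
    by_cases hij : i = j
    · subst hij; simp [graphLaplacian, ha_diag]
    · simp [graphLaplacian, hij]
  simp [Matrix.mulVec, dotProduct, h, Finset.sum_sub_distrib]

/-- The entrywise absolute value of a left null vector of a Laplacian is a left null vector. -/
theorem vecMul_abs_graphLaplacian {N : ℕ} {a : Fin N → Fin N → ℝ} (ha_nonneg : ∀ i j, 0 ≤ a i j)
    (ha_diag : ∀ i, a i i = 0) {v : Fin N → ℝ} (hv : Matrix.vecMul v (graphLaplacian a) = 0) :
    Matrix.vecMul (fun i => |v i|) (graphLaplacian a) = 0 := by
  have hle (j : Fin N) : |v j| * ∑ k, a j k ≤ ∑ i, |v i| * a i j := by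
    have hj := congrFun hv j
    rw [vecMul_graphLaplacian_apply ha_diag, Pi.zero_apply, sub_eq_zero] at hj
    calc |v j| * ∑ k, a j k = |∑ i, v i * a i j| := by
          rw [← hj, abs_mul, abs_of_nonneg (Finset.sum_nonneg fun k _ => ha_nonneg j k)]
      _ ≤ ∑ i, |v i * a i j| := Finset.abs_sum_le_sum_abs _ _
      _ = ∑ i, |v i| * a i j := by simp only [abs_mul, abs_of_nonneg (ha_nonneg _ _)]
  have hsum : ∑ j, |v j| * ∑ k, a j k = ∑ j, ∑ i, |v i| * a i j := by
    rw [Finset.sum_comm]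
    simp only [Finset.mul_sum]
  funext j
  rw [vecMul_graphLaplacian_apply ha_diag, Pi.zero_apply, sub_eq_zero]
  exact (Finset.sum_eq_sum_iff_of_le fun j _ => hle j).1 hsum j (Finset.mem_univ j)

/-- A nonnegative left null vector of the Laplacian of a strongly connected digraph with a
vanishing entry is zero. -/
theorem eq_zero_of_vecMul_graphLaplacian_eq_zero {N : ℕ} {a : Fin N → Fin N → ℝ}
    (ha_nonneg : ∀ i j, 0 ≤ a i j) (ha_diag : ∀ i, a i i = 0) (hsc : StronglyConnected a)
    {w : Fin N → ℝ} (hw : ∀ i, 0 ≤ w i) (hL : Matrix.vecMul w (graphLaplacian a) = 0)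
    {i : Fin N} (hi : w i = 0) : w = 0 := by
  have step {u v : Fin N} (huv : 0 < a v u) (hu : w u = 0) : w v = 0 := by
    have h := congrFun hL u
    rw [vecMul_graphLaplacian_apply ha_diag, Pi.zero_apply, hu, zero_mul, zero_sub,
      neg_eq_zero, Finset.sum_eq_zero_iff_of_nonneg
        fun k _ => mul_nonneg (hw k) (ha_nonneg k u)] at h
    exact (mul_eq_zero.1 (h v (Finset.mem_univ v))).resolve_right huv.ne'
  funext j
  by_cases hij : i = j
  · exact hij ▸ hi
  · have hpath := hsc i j hij
    clear hij
    induction hpath with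
    | single h => exact step h hi
    | tail _ h ih => exact step h ih

theorem exists_normalized_positive_left_eigenvector
    (N : ℕ) (hN : 2 ≤ N) (a : Fin N → Fin N → ℝ)
    (ha_nonneg : ∀ i j, 0 ≤ a i j) (ha_diag : ∀ i, a i i = 0)
    (hsc : StronglyConnected a) :
    ∃ r : Fin N → ℝ, (∀ i, 0 < r i) ∧
      Matrix.vecMul r (graphLaplacian a) = 0 ∧ ∑ i, r i = 1 := by
  have : NeZero N := ⟨by omega⟩
  obtain ⟨v, hv0, hv⟩ := Matrix.exists_vecMul_eq_zero_iff.2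
    (Matrix.exists_mulVec_eq_zero_iff.1 ⟨1, one_ne_zero, graphLaplacian_mulVec_one ha_diag⟩)
  have hw := vecMul_abs_graphLaplacian ha_nonneg ha_diag hv
  have hpos (i : Fin N) : 0 < |v i| := by
    refine (abs_nonneg _).lt_of_ne fun h => hv0 ?_
    have h0 := eq_zero_of_vecMul_graphLaplacian_eq_zero ha_nonneg ha_diag hsc
      (fun i => abs_nonneg (v i)) hw h.symm
    exact funext fun j => abs_eq_zero.1 (congrFun h0 j)
  have hS : 0 < ∑ i, |v i| := Finset.sum_pos (fun i _ => hpos i) Finset.univ_nonempty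
  refine ⟨(∑ i, |v i|)⁻¹ • fun i => |v i|, fun i => mul_pos (inv_pos.2 hS) (hpos i), ?_, ?_⟩
  · rw [Matrix.smul_vecMul, hw, smul_zero]
  · simp only [Pi.smul_apply, smul_eq_mul, ← Finset.mul_sum]
    exact inv_mul_cancel₀ hS.ne'
end

section
/- Let G be a strongly connected weighted digraph on N nodes with Laplacian L, let r be a normalized positive left eigenvector of L for eigenvalue zero, and set R = diag(r_1,…,r_N). Then the symmetric matrix L̄ = (RL + LᵀR)/2 is positive semidefinite, and its kernel is exactly the span of the all-ones vector 1_N; equivalently, its eigenvalues can be ordered as 0 = λ_1 < λ_2 ≤ λ_3 ≤ … ≤ λ_N. -/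
open Matrix Finset

theorem graphLaplacian_eq_diagonal_sub {N : ℕ} {a : Fin N → Fin N → ℝ} (ha : ∀ i, a i i = 0) :
    graphLaplacian a = diagonal (fun i => ∑ k, a i k) - of a := by
  ext i j
  by_cases h : i = j
  · subst h
    simp [graphLaplacian, ha]
  · simp [graphLaplacian, h]

theorem graphLaplacian_mulVec_apply {N : ℕ} {a : Fin N → Fin N → ℝ} (ha : ∀ i, a i i = 0)
    (w : Fin N → ℝ) (i : Fin N) :
    (graphLaplacian a *ᵥ w) i = ∑ j, a i j * (w i - w j) := by
  rw [graphLaplacian_eq_diagonal_sub ha, sub_mulVec, Pi.sub_apply, mulVec_diagonal]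
  simp [mulVec, dotProduct, mul_sub, Finset.sum_mul]

/-- A left null vector of the Laplacian balances weighted in-degrees and out-degrees. -/
theorem mul_sum_eq_sum_mul_of_vecMul_graphLaplacian {N : ℕ} {a : Fin N → Fin N → ℝ}
    (ha : ∀ i, a i i = 0) {r : Fin N → ℝ} (hr : r ᵥ* graphLaplacian a = 0) (j : Fin N) :
    r j * ∑ k, a j k = ∑ i, r i * a i j := by
  have h := congrFun hr j
  rw [graphLaplacian_eq_diagonal_sub ha, vecMul_sub, Pi.sub_apply, vecMul_diagonal] at h
  simpa [vecMul, dotProduct, sub_eq_zero] using h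

/-- The quadratic form of `diagonal r * L` as a weighted sum of squared differences. -/
theorem dotProduct_diagonal_mul_graphLaplacian_mulVec {N : ℕ} {a : Fin N → Fin N → ℝ}
    (ha : ∀ i, a i i = 0) {r : Fin N → ℝ} (hr : r ᵥ* graphLaplacian a = 0) (w : Fin N → ℝ) :
    w ⬝ᵥ ((diagonal r * graphLaplacian a) *ᵥ w) =
      (1 / 2) * ∑ i, ∑ j, r i * a i j * (w i - w j) ^ 2 := by
  have balance : ∑ i, ∑ j, r i * a i j * w i ^ 2 = ∑ i, ∑ j, r i * a i j * w j ^ 2 := by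
    rw [Finset.sum_comm (f := fun i j => r i * a i j * w j ^ 2)]
    refine Finset.sum_congr rfl fun j _ => ?_
    rw [← Finset.sum_mul, ← Finset.sum_mul, ← Finset.mul_sum,
      mul_sum_eq_sum_mul_of_vecMul_graphLaplacian ha hr]
  have expand : w ⬝ᵥ ((diagonal r * graphLaplacian a) *ᵥ w) =
      ∑ i, ∑ j, r i * a i j * (w i ^ 2 - w i * w j) := by
    rw [← mulVec_mulVec, dotProduct]
    refine Finset.sum_congr rfl fun i _ => ?_
    rw [mulVec_diagonal, graphLaplacian_mulVec_apply ha, Finset.mul_sum, Finset.mul_sum]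
    exact Finset.sum_congr rfl fun j _ => by ring
  have square : ∑ i, ∑ j, r i * a i j * (w i - w j) ^ 2 =
      2 * ∑ i, ∑ j, r i * a i j * (w i ^ 2 - w i * w j) +
        (∑ i, ∑ j, r i * a i j * w j ^ 2 - ∑ i, ∑ j, r i * a i j * w i ^ 2) := by
    simp only [Finset.mul_sum, ← Finset.sum_sub_distrib, ← Finset.sum_add_distrib]
    exact Finset.sum_congr rfl fun i _ => Finset.sum_congr rfl fun j _ => by ring
  rw [expand, square, balance]
  ring

/-- The symmetrization of a matrix has the same quadratic form. -/
theorem dotProduct_half_smul_add_transpose_mulVec {n : Type*} [Fintype n] (M : Matrix n n ℝ)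
    (w : n → ℝ) : w ⬝ᵥ (((1 / 2 : ℝ) • (M + Mᵀ)) *ᵥ w) = w ⬝ᵥ (M *ᵥ w) := by
  have h : w ⬝ᵥ (Mᵀ *ᵥ w) = w ⬝ᵥ (M *ᵥ w) := by
    rw [mulVec_transpose, dotProduct_comm, ← dotProduct_mulVec]
  rw [smul_mulVec, add_mulVec, dotProduct_smul, dotProduct_add, h, smul_eq_mul]
  ring

/-- A function that agrees along every edge of a strongly connected digraph is constant. -/
theorem StronglyConnected.eq_of_forall_edge {N : ℕ} {a : Fin N → Fin N → ℝ}
    (hsc : StronglyConnected a) {α : Type*} {w : Fin N → α}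
    (hw : ∀ i j, 0 < a i j → w i = w j) (i j : Fin N) : w i = w j := by
  by_cases hij : i = j
  · rw [hij]
  · induction hsc i j hij with
    | single h => exact (hw _ _ h).symm
    | tail _ h ih =>
      rename_i u v _
      by_cases hu : i = u
      · rw [hu]; exact (hw _ _ h).symm
      · exact (ih hu).trans (hw _ _ h).symm

theorem posSemidef_symmetrized_laplacian_and_kernel
    (N : ℕ) (hN : 2 ≤ N) (a : Fin N → Fin N → ℝ)
    (ha_nonneg : ∀ i j, 0 ≤ a i j) (ha_diag : ∀ i, a i i = 0)
    (hsc : StronglyConnected a)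
    (r : Fin N → ℝ) (hr_pos : ∀ i, 0 < r i)
    (hr_left : Matrix.vecMul r (graphLaplacian a) = 0)
    (hr_sum : ∑ i, r i = 1) :
    letI L := graphLaplacian a
    letI R : Matrix (Fin N) (Fin N) ℝ := Matrix.diagonal r
    letI Lbar : Matrix (Fin N) (Fin N) ℝ := (1 / 2 : ℝ) • (R * L + Lᵀ * R)
    Lbar.PosSemidef ∧
      (∀ w : Fin N → ℝ, Lbar.mulVec w = 0 ↔ ∃ c : ℝ, w = fun _ => c) := by
  have hM : (graphLaplacian a)ᵀ * diagonal r = (diagonal r * graphLaplacian a)ᵀ := by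
    rw [transpose_mul, diagonal_transpose]
  have quad (w : Fin N → ℝ) := (dotProduct_half_smul_add_transpose_mulVec _ w).trans
    (dotProduct_diagonal_mul_graphLaplacian_mulVec ha_diag hr_left w)
  have term_nonneg (w : Fin N → ℝ) (i j : Fin N) : 0 ≤ r i * a i j * (w i - w j) ^ 2 :=
    mul_nonneg (mul_nonneg (hr_pos i).le (ha_nonneg i j)) (sq_nonneg _)
  rw [hM]
  refine ⟨PosSemidef.of_dotProduct_mulVec_nonneg ?_ fun w => ?_, fun w => ⟨fun hw => ?_, ?_⟩⟩
  · rw [IsHermitian, conjTranspose_eq_transpose_of_trivial, transpose_smul, transpose_add,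
      transpose_transpose, add_comm]
  · rw [star_trivial, quad]
    exact mul_nonneg (by norm_num)
      (Finset.sum_nonneg fun i _ => Finset.sum_nonneg fun j _ => term_nonneg w i j)
  · have sum_zero : ∑ i, ∑ j, r i * a i j * (w i - w j) ^ 2 = 0 := by
      have h := quad w
      rw [hw, dotProduct_zero] at h
      linarith
    refine ⟨w ⟨0, by lia⟩, funext fun k => hsc.eq_of_forall_edge (fun i j hij => ?_) _ _⟩
    have row_zero := (Finset.sum_eq_zero_iff_of_nonneg fun i _ =>
      Finset.sum_nonneg fun j _ => term_nonneg w i j).mp sum_zero i (Finset.mem_univ i)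
    have entry_zero := (Finset.sum_eq_zero_iff_of_nonneg fun j _ =>
      term_nonneg w i j).mp row_zero j (Finset.mem_univ j)
    have h := (mul_eq_zero.mp entry_zero).resolve_left (mul_pos (hr_pos i) hij).ne'
    exact sub_eq_zero.mp (pow_eq_zero_iff two_ne_zero |>.mp h)
  · rintro ⟨c, rfl⟩
    have right_null : graphLaplacian a *ᵥ (fun _ => c) = 0 := by
      ext i
      simp [graphLaplacian_mulVec_apply ha_diag]
    have scaled : diagonal r *ᵥ (fun _ => c) = c • r := by
      ext i
      simp [mulVec_diagonal, mul_comm]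
    rw [← hM, smul_mulVec, add_mulVec, ← mulVec_mulVec, ← mulVec_mulVec, right_null, scaled,
      mulVec_smul, mulVec_transpose, hr_left]
    simp
end

section
/- Let g : ℝ × ℝⁿ → ℝⁿ be continuous and continuously differentiable with respect to x, with g(t,0) = 0 for all t and with the Jacobian ∂g/∂x bounded: ∥∂g/∂x(t,x)∥ ≤ L₀ for some L₀ > 0 and all (t,x). Suppose the origin is a globally exponentially stable equilibrium of the nominal system ẋ = g(t,x), i.e. there exist k, λ > 0 such that every solution satisfies ∥x(t)∥ ≤ k ∥x(t₀)∥ e^{−λ(t−t₀)} for all t ≥ t₀. Let κ : ℝ × ℝⁿ → ℝⁿ be continuous with κ(t,0) = 0 and ∥κ(t,x)∥ ≤ γ(t)∥x∥ for all (t,x), where γ : ℝ → [0,∞) is continuous with γ(t) → 0 as t → ∞. Then the origin is an exponentially stable equilibrium of the perturbed system ẋ = g(t,x) + κ(t,x): there exist T ≥ 0, k' > 0 and λ' > 0 such that every solution of the perturbed system satisfies ∥x(t)∥ ≤ k' ∥x(t₀)∥ e^{−λ'(t−t₀)} for all t ≥ t₀ ≥ T. -/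
open Filter Real

/-- Solutions of an ODE whose right-hand side is globally Lipschitz and vanishes at the origin exist
on time intervals whose length does not depend on the initial condition. -/
theorem exists_uniform_time_hasDerivAt_of_lipschitzWith {E : Type*} [NormedAddCommGroup E]
    [NormedSpace ℝ E] [CompleteSpace E] {v : ℝ → E → E} {K : NNReal}
    (hcont : ∀ x, Continuous fun t => v t x) (hlip : ∀ t, LipschitzWith K (v t))
    (hzero : ∀ t, v t 0 = 0) :
    ∃ h : ℝ, 0 < h ∧ ∀ (s : ℝ) (x₀ : E), ∃ α : ℝ → E, α s = x₀ ∧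
      ∀ t ∈ Set.Icc (s - h) (s + h), HasDerivAt α (v t (α t)) t := by
  refine ⟨1 / (4 * (K + 1)), by positivity, fun s x₀ => ?_⟩
  set h : ℝ := 1 / (4 * (K + 1)) with h_def
  have hpos : 0 < h := by positivity
  have hK : 2 * h * K ≤ 1 / 2 := by
    have : (K : ℝ) / (K + 1) ≤ 1 := by
      rw [div_le_one (by positivity)]
      linarith
    calc 2 * h * K = 1 / 2 * ((K : ℝ) / (K + 1)) := by rw [h_def]; field_simp; norm_num
      _ ≤ 1 / 2 := by linarith
  have hs : s ∈ Set.Icc (s - 2 * h) (s + 2 * h) := ⟨by linarith, by linarith⟩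
  have hPL : IsPicardLindelof v (⟨s, hs⟩ : Set.Icc (s - 2 * h) (s + 2 * h)) x₀
      (‖x₀‖₊ + 1) 0 (K * (2 * ‖x₀‖₊ + 1)) K := by
    refine ⟨fun t _ => (hlip t).lipschitzOnWith, fun x _ => (hcont x).continuousOn, ?_, ?_⟩
    · intro t _ x hx
      have hgrowth : ‖v t x‖ ≤ K * ‖x‖ := by
        simpa [hzero t] using (hlip t).norm_sub_le x 0
      have hxnorm : ‖x‖ ≤ 2 * ‖x₀‖ + 1 := by
        have hball : ‖x - x₀‖ ≤ ‖x₀‖ + 1 := by simpa [dist_eq_norm] using hx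
        linarith [norm_le_norm_add_norm_sub' x x₀]
      calc ‖v t x‖ ≤ K * ‖x‖ := hgrowth
        _ ≤ K * (2 * ‖x₀‖ + 1) := by gcongr
        _ = ((K * (2 * ‖x₀‖₊ + 1) : NNReal) : ℝ) := by push_cast; rfl
    · have hmax : max (s + 2 * h - s) (s - (s - 2 * h)) = 2 * h := by
        rw [add_sub_cancel_left, sub_sub_cancel, max_self]
      simp only [hmax]
      push_cast
      nlinarith [norm_nonneg x₀]
  obtain ⟨α, hα, hderiv⟩ := hPL.exists_eq_forall_mem_Icc_hasDerivWithinAt₀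
  refine ⟨α, hα, fun t ht => (hderiv t ?_).hasDerivAt (Icc_mem_nhds ?_ ?_)⟩
  · exact ⟨by linarith [ht.1], by linarith [ht.2]⟩
  · linarith [ht.1]
  · linarith [ht.2]

/-- An ODE whose right-hand side is globally Lipschitz and vanishes at the origin has solutions for
all future times. -/
theorem exists_forall_ge_hasDerivAt_of_lipschitzWith {E : Type*} [NormedAddCommGroup E]
    [NormedSpace ℝ E] [CompleteSpace E] {v : ℝ → E → E} {K : NNReal}
    (hcont : ∀ x, Continuous fun t => v t x) (hlip : ∀ t, LipschitzWith K (v t))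
    (hzero : ∀ t, v t 0 = 0) (s : ℝ) (x₀ : E) :
    ∃ y : ℝ → E, y s = x₀ ∧ ∀ t, s ≤ t → HasDerivAt y (v t (y t)) t := by
  obtain ⟨h, hpos, hloc⟩ := exists_uniform_time_hasDerivAt_of_lipschitzWith hcont hlip hzero
  choose φ hφ hφderiv using hloc
  let p : ℕ → E := fun n => Nat.rec x₀ (fun m z => φ (s + m * h) z (s + (m + 1 : ℕ) * h)) n
  have hp : ∀ m : ℕ, p (m + 1) = φ (s + m * h) (p m) (s + (m + 1 : ℕ) * h) := fun _ => rfl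
  let y : ℝ → E := fun t => φ (s + ⌊(t - s) / h⌋₊ * h) (p ⌊(t - s) / h⌋₊) t
  have hIco : ∀ (n : ℕ) (t : ℝ), s + n * h ≤ t → t < s + (n + 1 : ℕ) * h →
      y t = φ (s + n * h) (p n) t := by
    intro n t h₁ h₂
    have hfloor : ⌊(t - s) / h⌋₊ = n := by
      rw [Nat.floor_eq_iff (div_nonneg (by nlinarith [n.cast_nonneg (α := ℝ)]) hpos.le),
        le_div_iff₀ hpos, div_lt_iff₀ hpos]
      push_cast at h₂
      constructor <;> linarith
    simp only [y, hfloor]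
  have hnode : ∀ n : ℕ, y (s + n * h) = p n := by
    intro n
    rw [hIco n _ le_rfl (by push_cast; linarith), hφ]
  have hIcc : ∀ (n : ℕ) (t : ℝ), s + n * h ≤ t → t ≤ s + (n + 1 : ℕ) * h →
      y t = φ (s + n * h) (p n) t := by
    intro n t h₁ h₂
    rcases h₂.lt_or_eq with h₂ | rfl
    · exact hIco n t h₁ h₂
    · rw [hnode, hp]
  have hIic : ∀ t, t ≤ s → y t = φ s x₀ t := by
    intro t ht
    have hfloor : ⌊(t - s) / h⌋₊ = 0 :=
      Nat.floor_of_nonpos (div_nonpos_of_nonpos_of_nonneg (by linarith) hpos.le)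
    simp only [y, hfloor, Nat.cast_zero, zero_mul, add_zero]
    rfl
  have hpiece : ∀ (n : ℕ) (t : ℝ), s + n * h ≤ t → t ≤ s + (n + 1 : ℕ) * h →
      HasDerivAt (φ (s + n * h) (p n)) (v t (y t)) t := by
    intro n t h₁ h₂
    rw [hIcc n t h₁ h₂]
    refine hφderiv _ _ t ⟨by linarith, ?_⟩
    push_cast at h₂
    linarith
  refine ⟨y, by simpa [p] using hnode 0, fun t ht => ?_⟩
  have hright : HasDerivWithinAt y (v t (y t)) (Set.Ici t) t := by
    have hnonneg : 0 ≤ (t - s) / h := div_nonneg (by linarith) hpos.le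
    have h₁ : s + ⌊(t - s) / h⌋₊ * h ≤ t := by
      have := (le_div_iff₀ hpos).1 (Nat.floor_le hnonneg)
      linarith
    have h₂ : t < s + (⌊(t - s) / h⌋₊ + 1 : ℕ) * h := by
      have := (div_lt_iff₀ hpos).1 (Nat.lt_floor_add_one ((t - s) / h))
      push_cast
      linarith
    refine (hpiece _ t h₁ h₂.le).hasDerivWithinAt.congr_of_eventuallyEq ?_ (hIcc _ t h₁ h₂.le)
    filter_upwards [Icc_mem_nhdsGE h₂] with r hr
    exact hIcc _ r (h₁.trans hr.1) hr.2
  have hleft : HasDerivWithinAt y (v t (y t)) (Set.Iic t) t := by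
    rcases ht.eq_or_lt with rfl | ht
    · have hderiv := hpiece 0 s (by simp) (by simp [hpos.le])
      simp only [Nat.cast_zero, zero_mul, add_zero] at hderiv
      exact hderiv.hasDerivWithinAt.congr (fun r hr => hIic r hr) (hIic s le_rfl)
    · obtain ⟨n, hn⟩ : ∃ n : ℕ, ⌈(t - s) / h⌉₊ = n + 1 :=
        Nat.exists_eq_succ_of_ne_zero (Nat.ceil_pos.2 (div_pos (by linarith) hpos)).ne'
      have h₁ : s + n * h < t := by
        have := (lt_div_iff₀ hpos).1 (Nat.lt_ceil.1 (n.lt_succ_self.trans_eq hn.symm))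
        linarith
      have h₂ : t ≤ s + (n + 1 : ℕ) * h := by
        have := (div_le_iff₀ hpos).1 (Nat.ceil_le.1 hn.le)
        linarith
      refine (hpiece n t h₁.le h₂).hasDerivWithinAt.congr_of_eventuallyEq ?_ (hIcc n t h₁.le h₂)
      filter_upwards [Icc_mem_nhdsLE h₁] with r hr
      exact hIcc n r hr.1 (hr.2.trans h₂)
  simpa [Set.Iic_union_Ici] using hleft.union hright

/-- A function which is halved over each time step `τ` and grows by at most a factor `M` within a
time step decays exponentially. -/
theorem le_mul_exp_of_le_half {u : ℝ → ℝ} {t₀ τ M : ℝ} (hτ : 0 < τ) (hM : 0 ≤ M)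
    (hu : 0 ≤ u t₀)
    (hhalf : ∀ s, t₀ ≤ s → u (s + τ) ≤ 1 / 2 * u s)
    (hgrowth : ∀ s, t₀ ≤ s → ∀ t ∈ Set.Icc s (s + τ), u t ≤ M * u s) {t : ℝ} (ht : t₀ ≤ t) :
    u t ≤ 2 * M * u t₀ * exp (-(log 2 / τ) * (t - t₀)) := by
  have hiter : ∀ n : ℕ, u (t₀ + n * τ) ≤ (1 / 2) ^ n * u t₀ := by
    intro n
    induction n with
    | zero => simp
    | succ n ih =>
      have hstep := hhalf (t₀ + n * τ) (by nlinarith [n.cast_nonneg (α := ℝ)])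
      rw [show t₀ + ((n + 1 : ℕ) : ℝ) * τ = t₀ + n * τ + τ by push_cast; ring, pow_succ]
      linarith
  set n := ⌊(t - t₀) / τ⌋₊
  have h₁ : n * τ ≤ t - t₀ :=
    (le_div_iff₀ hτ).1 (Nat.floor_le (div_nonneg (by linarith) hτ.le))
  have h₂ : (t - t₀) / τ < n + 1 := Nat.lt_floor_add_one _
  have h₂' : t - t₀ < (n + 1) * τ := (div_lt_iff₀ hτ).1 h₂
  have hpow : ((1 : ℝ) / 2) ^ n ≤ 2 * exp (-(log 2 / τ) * (t - t₀)) := by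
    have hlog : 0 < log 2 := log_pos one_lt_two
    have hexp : ((1 : ℝ) / 2) ^ n = exp (-(n * log 2)) := by
      rw [exp_neg, mul_comm, exp_mul, exp_log two_pos, rpow_natCast, one_div, inv_pow]
    calc ((1 : ℝ) / 2) ^ n = exp (-(n * log 2)) := hexp
      _ ≤ exp (log 2 + -(log 2 / τ) * (t - t₀)) := by
        apply exp_le_exp.2
        have : -(log 2 / τ) * (t - t₀) = -(log 2 * ((t - t₀) / τ)) := by ring
        nlinarith
      _ = 2 * exp (-(log 2 / τ) * (t - t₀)) := by rw [exp_add, exp_log two_pos]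
  calc u t ≤ M * u (t₀ + n * τ) :=
        hgrowth _ (by nlinarith [n.cast_nonneg (α := ℝ)]) t ⟨by linarith, by linarith⟩
    _ ≤ M * ((1 / 2) ^ n * u t₀) := by gcongr; exact hiter n
    _ ≤ M * (2 * exp (-(log 2 / τ) * (t - t₀)) * u t₀) := by gcongr
    _ = 2 * M * u t₀ * exp (-(log 2 / τ) * (t - t₀)) := by ring

/-- The distance, after time `t - s`, between a solution `y` of `ẏ = v t y` and a solution `x` of a
perturbation of this equation starting from the same point, when the perturbation is at most
`ε * ‖x‖` with `ε ≤ 1`. The bound on `‖x‖` is the Grönwall bound of the perturbed equation. -/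
theorem norm_le_and_dist_le_of_linear_perturbation {E : Type*} [NormedAddCommGroup E]
    [NormedSpace ℝ E] {v w : ℝ → E → E} {K : NNReal} {x y : ℝ → E} {s τ ε : ℝ}
    (hlip : ∀ t, LipschitzWith K (v t)) (hzero : ∀ t, v t 0 = 0) (hε : 0 ≤ ε) (hε₁ : ε ≤ 1)
    (hw : ∀ t, s ≤ t → ∀ z, ‖w t z‖ ≤ ε * ‖z‖)
    (hx : ∀ t, s ≤ t → HasDerivAt x (v t (x t) + w t (x t)) t)
    (hy : ∀ t, s ≤ t → HasDerivAt y (v t (y t)) t) (hxy : y s = x s) :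
    ∀ t ∈ Set.Icc s (s + τ), ‖x t‖ ≤ exp ((K + 1) * τ) * ‖x s‖ ∧
      dist (x t) (y t) ≤ gronwallBound 0 K (ε * (exp ((K + 1) * τ) * ‖x s‖)) τ := by
  have hxcont : ContinuousOn x (Set.Icc s (s + τ)) :=
    fun t ht => (hx t ht.1).continuousAt.continuousWithinAt
  have hycont : ContinuousOn y (Set.Icc s (s + τ)) :=
    fun t ht => (hy t ht.1).continuousAt.continuousWithinAt
  have hxnorm : ∀ t ∈ Set.Icc s (s + τ), ‖x t‖ ≤ exp ((K + 1) * τ) * ‖x s‖ := by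
    intro t ht
    have hbound := norm_le_gronwallBound_of_norm_deriv_right_le (K := (K : ℝ) + 1) (ε := 0) hxcont
      (fun r hr => (hx r hr.1).hasDerivWithinAt) le_rfl (fun r hr => by
        have hv : ‖v r (x r)‖ ≤ K * ‖x r‖ := by
          simpa [hzero r] using (hlip r).norm_sub_le (x r) 0
        have := norm_add_le (v r (x r)) (w r (x r))
        have := hw r hr.1 (x r)
        nlinarith [norm_nonneg (x r)]) t ht
    rw [gronwallBound_ε0, mul_comm] at hbound
    refine hbound.trans ?_
    gcongr
    linarith [ht.2]
  refine fun t ht => ⟨hxnorm t ht, ?_⟩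
  have hdist := dist_le_of_approx_trajectories_ODE (δ := 0) (εg := 0)
    (εf := ε * (exp ((K + 1) * τ) * ‖x s‖)) hlip hxcont
    (fun r hr => (hx r hr.1).hasDerivWithinAt)
    (fun r hr => by
      rw [dist_eq_norm, add_sub_cancel_left]
      exact (hw r hr.1 _).trans
        (mul_le_mul_of_nonneg_left (hxnorm r (Set.Ico_subset_Icc_self hr)) hε))
    hycont (fun r hr => (hy r hr.1).hasDerivWithinAt) (fun r hr => by simp) (by simp [hxy]) t ht
  rw [add_zero] at hdist
  exact hdist.trans (gronwallBound_mono le_rfl (by positivity) K.2 (by linarith [ht.2]))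

/-- Exponential stability of a perturbed system (Lemma 4 of the paper,
combining Corollary 9.1 and Lemma 9.5 of Khalil). -/
theorem perturbed_system_exponentially_stable
    (n : ℕ)
    (g κ : ℝ → EuclideanSpace ℝ (Fin n) → EuclideanSpace ℝ (Fin n))
    (γ : ℝ → ℝ) (L₀ k lam : ℝ) (hL₀ : 0 < L₀) (hk : 0 < k) (hlam : 0 < lam)
    -- `g` is continuous and continuously differentiable in `x`
    (hg_cont : Continuous fun p : ℝ × EuclideanSpace ℝ (Fin n) => g p.1 p.2)
    (hg_contDiff : ∀ t, ContDiff ℝ 1 (g t))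
    (hg_zero : ∀ t, g t 0 = 0)
    -- the Jacobian of `g` with respect to `x` is bounded
    (hg_jac : ∀ t x, ‖fderiv ℝ (g t) x‖ ≤ L₀)
    -- the origin is a globally exponentially stable equilibrium of `ẋ = g(t,x)`
    (hGES : ∀ (x : ℝ → EuclideanSpace ℝ (Fin n)) (t₀ : ℝ),
      (∀ t, t₀ ≤ t → HasDerivAt x (g t (x t)) t) →
      ∀ t, t₀ ≤ t → ‖x t‖ ≤ k * ‖x t₀‖ * Real.exp (-lam * (t - t₀)))
    -- the perturbation is continuous, vanishes at the origin, and is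
    -- linearly bounded with a vanishing coefficient
    (hκ_cont : Continuous fun p : ℝ × EuclideanSpace ℝ (Fin n) => κ p.1 p.2)
    (hκ_zero : ∀ t, κ t 0 = 0)
    (hγ_cont : Continuous γ) (hγ_nonneg : ∀ t, 0 ≤ γ t)
    (hκ_bound : ∀ t x, ‖κ t x‖ ≤ γ t * ‖x‖)
    (hγ_tendsto : Tendsto γ atTop (nhds 0)) :
    ∃ T : ℝ, 0 ≤ T ∧ ∃ k' > (0 : ℝ), ∃ lam' > (0 : ℝ),
      ∀ (x : ℝ → EuclideanSpace ℝ (Fin n)) (t₀ : ℝ), T ≤ t₀ →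
        (∀ t, t₀ ≤ t → HasDerivAt x (g t (x t) + κ t (x t)) t) →
        ∀ t, t₀ ≤ t → ‖x t‖ ≤ k' * ‖x t₀‖ * Real.exp (-lam' * (t - t₀)) := by
  have hlip : ∀ t, LipschitzWith (NNReal.mk L₀ hL₀.le) (g t) := fun t =>
    lipschitzWith_of_nnnorm_fderiv_le ((hg_contDiff t).differentiable one_ne_zero)
      fun x => hg_jac t x
  have hcont : ∀ x, Continuous fun t => g t x := fun x =>
    hg_cont.comp (continuous_id.prodMk continuous_const)
  obtain ⟨τ, hτ, hτdecay⟩ : ∃ τ : ℝ, 0 < τ ∧ k * exp (-lam * τ) ≤ 1 / 4 := by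
    have hlim : Tendsto (fun τ : ℝ => k * exp (-lam * τ)) atTop (nhds (k * 0)) :=
      (tendsto_exp_atBot.comp
        (tendsto_id.const_mul_atTop_of_neg (neg_neg_of_pos hlam))).const_mul k
    rw [mul_zero] at hlim
    obtain ⟨τ, h₁, h₂⟩ :=
      ((eventually_gt_atTop 0).and (hlim.eventually_le_const (by norm_num : (0 : ℝ) < 1 / 4))).exists
    exact ⟨τ, h₁, h₂⟩
  set M : ℝ := exp ((L₀ + 1) * τ)
  set C : ℝ := M / L₀ * (exp (L₀ * τ) - 1)
  have hC : 0 ≤ C :=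
    mul_nonneg (by positivity) (sub_nonneg.2 (one_le_exp (by positivity)))
  set ε : ℝ := 1 / (4 * C + 1)
  have hε : 0 < ε := by positivity
  have hε₁ : ε ≤ 1 := (div_le_one (by positivity)).2 (by linarith)
  have hεC : ε * C ≤ 1 / 4 := by
    rw [div_mul_eq_mul_div, div_le_iff₀ (by positivity)]
    linarith
  obtain ⟨T, hT⟩ := eventually_atTop.1 (hγ_tendsto.eventually_le_const hε)
  refine ⟨max T 0, le_max_right _ _, 2 * M, by positivity, log 2 / τ,
    div_pos (log_pos one_lt_two) hτ, fun x t₀ ht₀ hx t ht => ?_⟩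
  have hstep : ∀ s, t₀ ≤ s → ∃ y : ℝ → EuclideanSpace ℝ (Fin n), ‖y (s + τ)‖ ≤ 1 / 4 * ‖x s‖ ∧
      ∀ t ∈ Set.Icc s (s + τ), ‖x t‖ ≤ M * ‖x s‖ ∧ dist (x t) (y t) ≤ 1 / 4 * ‖x s‖ := by
    intro s hs
    obtain ⟨y, hys, hy⟩ := exists_forall_ge_hasDerivAt_of_lipschitzWith hcont hlip hg_zero s (x s)
    refine ⟨y, ?_, fun r hr => ?_⟩
    · have hdecay := hGES y s hy (s + τ) (by linarith)
      rw [add_sub_cancel_left, hys] at hdecay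
      nlinarith [norm_nonneg (x s)]
    · have hκ : ∀ r, s ≤ r → ∀ z, ‖κ r z‖ ≤ ε * ‖z‖ := fun r hr z =>
        (hκ_bound r z).trans (mul_le_mul_of_nonneg_right
          (hT r ((le_max_left T 0).trans (ht₀.trans (hs.trans hr)))) (norm_nonneg z))
      obtain ⟨h₁, h₂⟩ := norm_le_and_dist_le_of_linear_perturbation hlip hg_zero hε.le hε₁ hκ
        (fun r hr => hx r (hs.trans hr)) hy hys r hr
      refine ⟨h₁, h₂.trans ?_⟩
      rw [NNReal.coe_mk, gronwallBound_of_K_ne_0 hL₀.ne']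
      calc 0 * exp (L₀ * τ) + ε * (M * ‖x s‖) / L₀ * (exp (L₀ * τ) - 1)
          = ε * C * ‖x s‖ := by simp only [C]; ring
        _ ≤ 1 / 4 * ‖x s‖ := by gcongr
  refine le_mul_exp_of_le_half (u := fun t => ‖x t‖) hτ (exp_pos _).le (norm_nonneg _)
    (fun s hs => ?_) (fun s hs r hr => ?_) ht
  · obtain ⟨y, hy, hxy⟩ := hstep s hs
    have hdist := (hxy (s + τ) ⟨by linarith, le_rfl⟩).2
    rw [dist_eq_norm] at hdist
    have := norm_le_norm_add_norm_sub' (x (s + τ)) (y (s + τ))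
    linarith
  · obtain ⟨y, -, hxy⟩ := hstep s hs
    exact (hxy r hr).1
end

section
/- Let A ∈ ℝ^{n×n}, B ∈ ℝ^{n×p}, C ∈ ℝ^{q×n}, and suppose the (n+q) × (2p) block matrix [[CB, 0_{q×p}], [−AB, B]] has rank n + q. Then there exist matrices Ψ ∈ ℝ^{n×q}, Φ ∈ ℝ^{p×q}, and Υ ∈ ℝ^{p×q} such that CΨ = I_q, BΦ = AΨ, and BΥ = Ψ. -/
open Matrix

/-- A matrix over a field whose rank equals its number of rows has a right inverse. -/
theorem Matrix.exists_right_inverse_of_rank_eq_card {m k K : Type*} [Fintype m] [Fintype k]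
    [DecidableEq m] [Field K] (M : Matrix m k K) (h : M.rank = Fintype.card m) :
    ∃ R : Matrix k m K, M * R = 1 := by
  rw [← Matrix.mulVec_surjective_iff_exists_right_inverse]
  have hrange : LinearMap.range M.mulVecLin = ⊤ := by
    apply Submodule.eq_top_of_finrank_eq
    rw [Module.finrank_fintype_fun_eq_card]
    exact h
  exact LinearMap.range_eq_top.mp hrange

/-- Solvability of the linear matrix equations (Lemma 5 of the paper):
if the block matrix `[[CB, 0], [-AB, B]]` has full row rank `n + q`, then the
matrix equations `CΨ = I`, `BΦ = AΨ`, `BΥ = Ψ` admit a solution triplet. -/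
theorem matrix_equations_solvable
    (n p q : ℕ)
    (A : Matrix (Fin n) (Fin n) ℝ) (B : Matrix (Fin n) (Fin p) ℝ)
    (C : Matrix (Fin q) (Fin n) ℝ)
    (hrank : (Matrix.fromBlocks (C * B) (0 : Matrix (Fin q) (Fin p) ℝ)
        (-(A * B)) B).rank = n + q) :
    ∃ (Ψ : Matrix (Fin n) (Fin q) ℝ) (Φ : Matrix (Fin p) (Fin q) ℝ)
      (Υ : Matrix (Fin p) (Fin q) ℝ),
      C * Ψ = 1 ∧ B * Φ = A * Ψ ∧ B * Υ = Ψ := by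
  obtain ⟨R, hR⟩ := Matrix.exists_right_inverse_of_rank_eq_card _
    (hrank.trans (by simp [add_comm]))
  rw [← Matrix.fromBlocks_toBlocks R, Matrix.fromBlocks_multiply, ← Matrix.fromBlocks_one,
    Matrix.fromBlocks_inj] at hR
  obtain ⟨h₁, -, h₂, -⟩ := hR
  refine ⟨B * R.toBlocks₁₁, R.toBlocks₂₁, R.toBlocks₁₁, ?_, ?_, rfl⟩
  · simpa [Matrix.mul_assoc] using h₁
  · rw [Matrix.neg_mul, neg_add_eq_zero] at h₂
    rw [← h₂, Matrix.mul_assoc]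
end

section
/- For i = 1,…,N let f_i : ℝ^q → ℝ be continuously differentiable and strongly convex with constant m_i > 0 and with ∇f_i globally Lipschitz. Let L be the Laplacian of a strongly connected weighted digraph on N nodes, r its normalized positive left eigenvector for eigenvalue zero, and R = diag(r_1,…,r_N). Suppose Ȳ = col(ȳ_1,…,ȳ_N) ∈ ℝ^{qN} and v̄ ∈ ℝ^{qN} satisfy, for some γ₂ > 0: (i) (L ⊗ I_q)Ȳ = 0; (ii) (R^{−1} ⊗ I_q)∇f̃(Ȳ) + γ₂ v̄ = 0, where ∇f̃(Ȳ) = col(∇f_1(ȳ_1),…,∇f_N(ȳ_N)); and (iii) (rᵀ ⊗ I_q) v̄ = 0. Then Ȳ = 1_N ⊗ y*, where y* is the unique minimizer of Σ_{i=1}^N f_i over ℝ^q. -/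
open Matrix Finset Kronecker

/-- The gradient of `f : ℝ^q → ℝ`, whose `s`-th component is the partial
derivative of `f` in the `s`-th coordinate direction. -/
noncomputable def grad {q : ℕ} (f : (Fin q → ℝ) → ℝ) (x : Fin q → ℝ) : Fin q → ℝ :=
  fun s => fderiv ℝ f x (Pi.single s 1)

/-- `f` is strongly convex with constant `m`:
`(x−y)ᵀ(∇f(x)−∇f(y)) ≥ m ∥x−y∥²` (Euclidean norm). -/
def StronglyConvexWith {q : ℕ} (m : ℝ) (f : (Fin q → ℝ) → ℝ) : Prop :=
  ∀ x y : Fin q → ℝ,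
    m * ∑ s, (x s - y s) ^ 2 ≤ ∑ s, (x s - y s) * (grad f x s - grad f y s)

/-- `grad f` is globally Lipschitz with constant `M` (stated in squared form,
equivalent to `∥∇f(x)−∇f(y)∥ ≤ M ∥x−y∥` for Euclidean norms). -/
def GradLipschitzWith {q : ℕ} (M : ℝ) (f : (Fin q → ℝ) → ℝ) : Prop :=
  ∀ x y : Fin q → ℝ,
    ∑ s, (grad f x s - grad f y s) ^ 2 ≤ M ^ 2 * ∑ s, (x s - y s) ^ 2

/-- Componentwise form of the Laplacian acting on a vector. -/
lemma graphLaplacian_mulVec {N : ℕ} {a : Fin N → Fin N → ℝ} (ha_diag : ∀ i, a i i = 0)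
    (x : Fin N → ℝ) (i : Fin N) :
    (graphLaplacian a).mulVec x i = ∑ k, a i k * (x i - x k) := by
  have h : ∀ k, graphLaplacian a i k * x k
      = (if i = k then (∑ l, a i l) * x k else 0) - a i k * x k := by
    intro k
    by_cases hk : i = k
    · subst hk
      simp [graphLaplacian, ha_diag]
    · simp [graphLaplacian, hk]
  simp only [Matrix.mulVec, dotProduct, h, Finset.sum_sub_distrib, mul_sub, Finset.sum_ite_eq,
    Finset.mem_univ, if_true, Finset.sum_mul]

/-- On a strongly connected digraph the kernel of the Laplacian consists of constant vectors. -/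
lemma eq_of_graphLaplacian_mulVec_eq_zero {N : ℕ} {a : Fin N → Fin N → ℝ}
    (ha_nonneg : ∀ i j, 0 ≤ a i j) (ha_diag : ∀ i, a i i = 0) (hsc : StronglyConnected a)
    {x : Fin N → ℝ} (hx : (graphLaplacian a).mulVec x = 0) (i j : Fin N) : x i = x j := by
  have : Nonempty (Fin N) := ⟨i⟩
  obtain ⟨p, hp⟩ := Finite.exists_max x
  have hstep : ∀ u v, 0 < a v u → x v = x p → x u = x p := by
    intro u v huv hv
    have h0 : ∑ k, a v k * (x v - x k) = 0 := by
      rw [← graphLaplacian_mulVec ha_diag, hx, Pi.zero_apply]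
    have h1 := (Finset.sum_eq_zero_iff_of_nonneg fun k _ =>
      mul_nonneg (ha_nonneg v k) (sub_nonneg.2 (hv ▸ hp k))).1 h0 u (Finset.mem_univ u)
    rcases mul_eq_zero.1 h1 with h | h
    · exact absurd h huv.ne'
    · linarith
  have hall : ∀ k, x k = x p := by
    intro k
    by_cases hk : k = p
    · rw [hk]
    · exact (hsc k p hk).head_induction_on (motive := fun u _ => x u = x p)
        (fun h => hstep _ _ h rfl) (fun h _ ih => hstep _ _ h ih)
  rw [hall i, hall j]

/-- A Kronecker product with an identity matrix acts on each coordinate slice separately. -/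
lemma kronecker_one_mulVec {m n q : Type*} [Fintype n] [Fintype q] [DecidableEq q]
    (A : Matrix m n ℝ) (y : n × q → ℝ) (i : m) (s : q) :
    (A ⊗ₖ (1 : Matrix q q ℝ)).mulVec y (i, s) = A.mulVec (fun j => y (j, s)) i := by
  simp [Matrix.mulVec, dotProduct, Fintype.sum_prod_type, Matrix.one_apply]

/-- First-order optimality: the gradients sum to zero at a minimizer of a sum. -/
lemma sum_grad_eq_zero_of_forall_le {N q : ℕ} {f : Fin N → (Fin q → ℝ) → ℝ} {x : Fin q → ℝ}
    (hf : ∀ i, DifferentiableAt ℝ (f i) x) (hx : ∀ y, ∑ i, f i x ≤ ∑ i, f i y) (s : Fin q) :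
    ∑ i, grad (f i) x s = 0 := by
  have hmin : IsLocalMin (fun y => ∑ i, f i y) x := Filter.Eventually.of_forall hx
  have h := hmin.fderiv_eq_zero
  rw [fderiv_fun_sum fun i _ => hf i] at h
  simpa [grad] using congrArg (fun T => T (Pi.single s 1)) h

/-- The sum of strongly convex functions has at most one point with a given total gradient. -/
lemma eq_of_sum_grad_eq {N q : ℕ} [NeZero N] {f : Fin N → (Fin q → ℝ) → ℝ} {m : Fin N → ℝ}
    (hm : ∀ i, 0 < m i) (hconv : ∀ i, StronglyConvexWith (m i) (f i)) {x y : Fin q → ℝ}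
    (h : ∀ s, ∑ i, grad (f i) x s = ∑ i, grad (f i) y s) : x = y := by
  have hle := Finset.sum_le_sum fun i (_ : i ∈ Finset.univ) => hconv i x y
  rw [Finset.sum_comm, ← Finset.sum_mul] at hle
  simp only [← Finset.mul_sum, Finset.sum_sub_distrib, h, sub_self, mul_zero,
    Finset.sum_const_zero] at hle
  have hpos : 0 < ∑ i, m i := Finset.sum_pos (fun i _ => hm i) Finset.univ_nonempty
  have hsq : ∑ s, (x s - y s) ^ 2 = 0 :=
    le_antisymm (nonpos_of_mul_nonpos_right hle hpos) (Finset.sum_nonneg fun s _ => sq_nonneg _)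
  funext s
  have hs := (Finset.sum_eq_zero_iff_of_nonneg fun s _ => sq_nonneg (x s - y s)).1 hsq s
    (Finset.mem_univ s)
  exact sub_eq_zero.1 (pow_eq_zero_iff two_ne_zero |>.1 hs)

/-- Lemma 6 of the paper: any equilibrium output `Ȳ` of the closed loop is the
consensus vector `1_N ⊗ y*` at the global optimum. -/
theorem equilibrium_output_is_optimal_consensus
    (N q : ℕ) (hN : 2 ≤ N) (a : Fin N → Fin N → ℝ)
    (ha_nonneg : ∀ i j, 0 ≤ a i j) (ha_diag : ∀ i, a i i = 0)
    (hsc : StronglyConnected a)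
    (r : Fin N → ℝ) (hr_pos : ∀ i, 0 < r i)
    (hr_left : Matrix.vecMul r (graphLaplacian a) = 0)
    (hr_sum : ∑ i, r i = 1)
    (f : Fin N → (Fin q → ℝ) → ℝ) (m M : Fin N → ℝ)
    (hm : ∀ i, 0 < m i) (hM : ∀ i, 0 < M i)
    (hC1 : ∀ i, ContDiff ℝ 1 (f i))
    (hconv : ∀ i, StronglyConvexWith (m i) (f i))
    (hlip : ∀ i, GradLipschitzWith (M i) (f i))
    (γ₂ : ℝ) (hγ₂ : 0 < γ₂)
    (Ybar vbar : Fin N × Fin q → ℝ)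
    -- (i)  (L ⊗ I_q) Ȳ = 0
    (hi : (graphLaplacian a ⊗ₖ (1 : Matrix (Fin q) (Fin q) ℝ)).mulVec Ybar = 0)
    -- (ii)  (R⁻¹ ⊗ I_q) ∇f̃(Ȳ) + γ₂ v̄ = 0
    (hii : ((Matrix.diagonal fun i => (r i)⁻¹) ⊗ₖ
        (1 : Matrix (Fin q) (Fin q) ℝ)).mulVec
        (fun p => grad (f p.1) (fun s => Ybar (p.1, s)) p.2) + γ₂ • vbar = 0)
    -- (iii)  (rᵀ ⊗ I_q) v̄ = 0
    (hiii : ∀ s : Fin q, ∑ i, r i * vbar (i, s) = 0)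
    (ystar : Fin q → ℝ)
    (hystar : ∀ y : Fin q → ℝ, ∑ i, f i ystar ≤ ∑ i, f i y) :
    ∀ i s, Ybar (i, s) = ystar s := by
  have hcons : ∀ i j s, Ybar (i, s) = Ybar (j, s) := by
    intro i j s
    refine eq_of_graphLaplacian_mulVec_eq_zero ha_nonneg ha_diag hsc
      (x := fun k => Ybar (k, s)) (funext fun k => ?_) i j
    rw [← kronecker_one_mulVec, hi]
    rfl
  have hgrad : ∀ i s, grad (f i) (fun t => Ybar (i, t)) s = -γ₂ * (r i * vbar (i, s)) := by
    intro i s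
    have h := congrFun hii (i, s)
    rw [Pi.add_apply, kronecker_one_mulVec, Matrix.mulVec_diagonal] at h
    simp only [Pi.smul_apply, smul_eq_mul, Pi.zero_apply] at h
    have hr := (hr_pos i).ne'
    field_simp at h
    linarith
  have : NeZero N := ⟨by omega⟩
  intro i s
  refine congrFun (eq_of_sum_grad_eq (x := fun t => Ybar (i, t)) hm hconv fun t => ?_) s
  rw [sum_grad_eq_zero_of_forall_le
    (fun j => ((hC1 j).differentiable one_ne_zero).differentiableAt) hystar t]
  calc ∑ j, grad (f j) (fun t => Ybar (i, t)) t
      = ∑ j, -γ₂ * (r j * vbar (j, t)) := Finset.sum_congr rfl fun j _ => by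
        rw [← hgrad j t, funext fun u => hcons i j u]
    _ = 0 := by rw [← Finset.mul_sum, hiii, mul_zero]
end

section
/- Consider N agents over a strongly connected weighted digraph with Laplacian L and normalized positive left eigenvector r (rᵀL = 0, Σ r_i = 1, r_i > 0), R = diag(r). For each i let C_i ∈ ℝ^{q×n_i}, Ψ_i ∈ ℝ^{n_i×q} with C_iΨ_i = I_q, and let A_{c,i} ∈ ℝ^{n_i×n_i} be Hurwitz; set C = diag(C_1,…,C_N), Ψ = diag(Ψ_1,…,Ψ_N), A_c = diag(A_{c,1},…,A_{c,N}). Let f_i : ℝ^q → ℝ be continuously differentiable and strongly convex with constant m_i > 0 and with ∇f_i globally Lipschitz with constant M_i > 0, and fix x̄ ∈ ℝ^{n_1+…+n_N}. Then there exist positive constants γ₁ and γ₂ such that every differentiable solution (x̃, ρ̃, ṽ) of the error system ẋ̃ = A_c(x̃ − Ψρ̃) + Ψ ρ̇̃, ρ̇̃ = −(R^{−1} ⊗ I_q) h − γ₁ (L ⊗ I_q) C x̃ − γ₂ ṽ, ṽ̇ = γ₁ (L ⊗ I_q) C x̃, with h = ∇f̃(C(x̄ + x̃)) − ∇f̃(C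 x̄) and (rᵀ ⊗ I_q) ṽ(0) = 0, converges exponentially to the origin: there exist c, λ > 0 with ∥x̃(t)∥ + ∥ρ̃(t)∥ + ∥ṽ(t)∥ ≤ c (∥x̃(0)∥ + ∥ρ̃(0)∥ + ∥ṽ(0)∥) e^{−λ t} for all t ≥ 0. -/
open Matrix Finset

/-- A real square matrix is Hurwitz if every complex eigenvalue (root of its
characteristic polynomial over `ℂ`) has negative real part. -/
def IsHurwitz {n : ℕ} (A : Matrix (Fin n) (Fin n) ℝ) : Prop :=
  ∀ μ : ℂ, (Matrix.charpoly (A.map Complex.ofReal)).IsRoot μ → μ.re < 0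

theorem exists_lyapunov_form_of_roots {E : Type*} [NormedAddCommGroup E] [InnerProductSpace ℂ E]
    (A : E →L[ℂ] E) (s : Multiset ℂ) (hs : ∀ μ ∈ s, μ.re < 0) :
    ∃ B : E →ₗ[ℝ] E →ₗ[ℝ] ℝ, ∃ c > (0 : ℝ), ∃ K : ℝ, 0 ≤ K ∧ (∀ x, ‖x‖ ^ 2 ≤ B x x) ∧
      ∀ x, B (A x) x + B x (A x) ≤ -c * ‖x‖ ^ 2 +
        K * ‖Polynomial.aeval A (s.map fun μ => Polynomial.X - Polynomial.C μ).prod x‖ ^ 2 := by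
  have hI : ∃ I : E →ₗ[ℝ] E →ₗ[ℝ] ℝ, ∀ x y, I x y = (inner ℂ x y : ℂ).re := by
    let _ : InnerProductSpace ℝ E := InnerProductSpace.rclikeToReal ℂ E
    exact ⟨innerₗ E, fun x y => rfl⟩
  obtain ⟨I, hI⟩ := hI
  have hII : ∀ x, I x x = ‖x‖ ^ 2 := fun x => by
    rw [hI]; exact (norm_sq_eq_re_inner (𝕜 := ℂ) x).symm
  have hIs : ∀ x y, I x y = I y x := fun x y => by
    rw [hI, hI, ← inner_conj_symm, Complex.conj_re]
  have hIle : ∀ x y, |I x y| ≤ ‖x‖ * ‖y‖ := fun x y => by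
    rw [hI]; exact (Complex.abs_re_le_norm _).trans (norm_inner_le_norm x y)
  induction s using Multiset.induction_on with
  | empty =>
    refine ⟨I, 1, one_pos, 2 * ‖A‖ + 1, by positivity, fun x => (hII x).ge, fun x => ?_⟩
    have h1 := (abs_le.1 (hIle (A x) x)).2
    have h2 := A.le_opNorm x
    have h3 : ‖A x‖ * ‖x‖ ≤ ‖A‖ * ‖x‖ * ‖x‖ := by gcongr
    rw [hIs x (A x)]
    simp only [Multiset.map_zero, Multiset.prod_zero, map_one, one_apply_eq_self]
    nlinarith
  | cons μ s ih =>
    obtain ⟨B, c, hc, K, hK, hB, hd⟩ := ih fun ν hν => hs ν (Multiset.mem_cons_of_mem hν)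
    have hμ : μ.re < 0 := hs μ (Multiset.mem_cons_self _ _)
    set T : E →L[ℂ] E := A - algebraMap ℂ _ μ with hT
    have hTx : ∀ x, T x = A x - μ • x := fun x => by
      simp [hT, Algebra.algebraMap_eq_smul_one]
    have hTA : ∀ x, T (A x) = A (T x) := fun x => by simp [hTx]
    set b : ℝ := (-μ.re)⁻¹ / c with hb
    have hb0 : 0 < b := by have : 0 < -μ.re := by linarith
                           positivity
    let TR : E →ₗ[ℝ] E := (T : E →ₗ[ℂ] E).restrictScalars ℝ
    have hTR : ∀ x, TR x = T x := fun x => rfl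
    refine ⟨I + b • (B.compl₁₂ TR TR), -μ.re, by linarith, b * K, by positivity,
      fun x => ?_, fun x => ?_⟩
    · have := (sq_nonneg ‖T x‖).trans (hB (T x))
      simp only [LinearMap.add_apply, LinearMap.smul_apply, LinearMap.compl₁₂_apply, hTR, hII,
        smul_eq_mul]
      nlinarith [mul_nonneg hb0.le this]
    · have h1 := mul_le_mul_of_nonneg_left (hd (T x)) hb0.le
      have hA : A x = μ • x + T x := by rw [hTx]; abel
      have hi : I x (A x) = μ.re * ‖x‖ ^ 2 + I x (T x) := by
        conv_lhs => rw [hA]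
        rw [map_add, ← hII x, hI x (μ • x), hI x x, inner_smul_right, Complex.mul_re]
        have : (inner ℂ x x : ℂ).im = 0 := inner_self_im (𝕜 := ℂ) x
        rw [this]; ring
      have hp : Polynomial.aeval A ((μ ::ₘ s).map fun μ => Polynomial.X - Polynomial.C μ).prod x =
          Polynomial.aeval A (s.map fun μ => Polynomial.X - Polynomial.C μ).prod (T x) := by
        rw [Multiset.map_cons, Multiset.prod_cons, mul_comm, map_mul]
        simp [hT]
      have h2 := (abs_le.1 (hIle x (T x))).2
      have hbc : b * c = (-μ.re)⁻¹ := by rw [hb]; field_simp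
      have h3 : 2 * (‖x‖ * ‖T x‖) ≤ -μ.re * ‖x‖ ^ 2 + (-μ.re)⁻¹ * ‖T x‖ ^ 2 := by
        have hm : 0 < -μ.re := by linarith
        have hne : μ.re ≠ 0 := hμ.ne
        have : -μ.re * ‖x‖ ^ 2 + (-μ.re)⁻¹ * ‖T x‖ ^ 2 - 2 * (‖x‖ * ‖T x‖) =
          (-μ.re)⁻¹ * (-μ.re * ‖x‖ - ‖T x‖) ^ 2 := by field_simp; ring
        have : 0 ≤ (-μ.re)⁻¹ * (-μ.re * ‖x‖ - ‖T x‖) ^ 2 := by positivity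
        linarith
      rw [hp]
      simp only [LinearMap.add_apply, LinearMap.smul_apply, LinearMap.compl₁₂_apply, hTR,
        smul_eq_mul, hIs (A x) x, hi, hTA]
      rw [← hbc] at h3
      nlinarith

theorem IsHurwitz.exists_lyapunov_form {n : ℕ} {A : Matrix (Fin n) (Fin n) ℝ} (hA : IsHurwitz A) :
    ∃ B : (Fin n → ℝ) →ₗ[ℝ] (Fin n → ℝ) →ₗ[ℝ] ℝ, ∃ c > (0 : ℝ), (∀ x, ∑ s, x s ^ 2 ≤ B x x) ∧
      ∀ x, B (A.mulVec x) x + B x (A.mulVec x) ≤ -c * ∑ s, x s ^ 2 := by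
  set A' := A.map Complex.ofReal with hA'
  obtain ⟨B, c, hc, K, -, hB, hd⟩ := exists_lyapunov_form_of_roots
    (Matrix.toEuclideanCLM (n := Fin n) (𝕜 := ℂ) A') A'.charpoly.roots
    fun μ hμ => hA μ (Polynomial.isRoot_of_mem_roots hμ)
  have hp : (A'.charpoly.roots.map fun μ => Polynomial.X - Polynomial.C μ).prod = A'.charpoly :=
    ((IsAlgClosed.splits A'.charpoly).eq_prod_roots_of_monic A'.charpoly_monic).symm
  have h0 : Polynomial.aeval (Matrix.toEuclideanCLM (n := Fin n) (𝕜 := ℂ) A') A'.charpoly = 0 := by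
    have := Polynomial.aeval_algHom_apply (Matrix.toEuclideanCLM (n := Fin n) (𝕜 := ℂ)) A' A'.charpoly
    rw [this, Matrix.aeval_self_charpoly, map_zero]
  let J : (Fin n → ℝ) →ₗ[ℝ] EuclideanSpace ℂ (Fin n) :=
    { toFun := fun x => WithLp.toLp 2 fun s => (x s : ℂ)
      map_add' := fun x y => by ext s; simp
      map_smul' := fun k x => by ext s; simp }
  have hJ : ∀ x, ‖J x‖ ^ 2 = ∑ s, x s ^ 2 := fun x => by
    simp [J, EuclideanSpace.norm_sq_eq]
  have hJA : ∀ x, J (A.mulVec x) = Matrix.toEuclideanCLM (n := Fin n) (𝕜 := ℂ) A' (J x) := fun x => by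
    ext s
    simp [J, hA', Matrix.mulVec, dotProduct]
  refine ⟨B.compl₁₂ J J, c, hc, fun x => ?_, fun x => ?_⟩
  · simpa [hJ] using hB (J x)
  · have := hd (J x)
    rw [hp, h0] at this
    simpa [hJ, hJA] using this

theorem exists_pos_forall_le {ι : Type*} [Fintype ι] (K : ι → ℝ) : ∃ b > (0 : ℝ), ∀ i, K i ≤ b := by
  refine ⟨1 + ∑ i, |K i|, by positivity, fun i => ?_⟩
  have := Finset.single_le_sum (f := fun i => |K i|) (fun _ _ => abs_nonneg _) (Finset.mem_univ i)
  linarith [le_abs_self (K i)]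

theorem exists_pos_forall_ge {ι : Type*} [Fintype ι] (K : ι → ℝ) (hK : ∀ i, 0 < K i) :
    ∃ b > (0 : ℝ), ∀ i, b ≤ K i := by
  obtain ⟨b, hb, h⟩ := exists_pos_forall_le fun i => (K i)⁻¹
  exact ⟨b⁻¹, inv_pos.2 hb, fun i => inv_le_of_inv_le₀ (hK i) (h i)⟩

theorem exists_sum_sq_mulVec_le {m n : Type*} [Fintype m] [Fintype n] (A : Matrix m n ℝ) :
    ∃ K > (0 : ℝ), ∀ x : n → ℝ, ∑ s, (A.mulVec x s) ^ 2 ≤ K * ∑ s, x s ^ 2 := by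
  refine ⟨1 + ∑ s, ∑ k, A s k ^ 2, by positivity, fun x => ?_⟩
  have h : ∑ s, (A.mulVec x s) ^ 2 ≤ ∑ s, (∑ k, A s k ^ 2) * ∑ k, x k ^ 2 :=
    Finset.sum_le_sum fun s _ => Finset.sum_mul_sq_le_sq_mul_sq _ _ _
  rw [← Finset.sum_mul] at h
  have : 0 ≤ ∑ k, x k ^ 2 := by positivity
  linarith

theorem exists_bilin_self_le {n : ℕ} (B : (Fin n → ℝ) →ₗ[ℝ] (Fin n → ℝ) →ₗ[ℝ] ℝ) :
    ∃ K > (0 : ℝ), ∀ x, B x x ≤ K * ∑ s, x s ^ 2 := by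
  obtain ⟨K, hK, h⟩ := exists_sum_sq_mulVec_le (LinearMap.toMatrix₂' ℝ B)
  refine ⟨1 + K, by positivity, fun x => ?_⟩
  have e : B x x = ∑ s, x s * ((LinearMap.toMatrix₂' ℝ B).mulVec x) s := by
    conv_lhs => rw [← Matrix.toLinearMap₂'_toMatrix' (R := ℝ) B, Matrix.toLinearMap₂'_apply']
    rfl
  have h2 : B x x ≤ ∑ s, (x s ^ 2 + ((LinearMap.toMatrix₂' ℝ B).mulVec x) s ^ 2) := by
    rw [e]
    refine Finset.sum_le_sum fun s _ => ?_
    nlinarith [sq_nonneg (x s - ((LinearMap.toMatrix₂' ℝ B).mulVec x) s),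
      sq_nonneg (x s), sq_nonneg (((LinearMap.toMatrix₂' ℝ B).mulVec x) s)]
  rw [Finset.sum_add_distrib] at h2
  linarith [h x]

theorem graphLaplacian_sum_mul {N : ℕ} (a : Fin N → Fin N → ℝ) (ha_diag : ∀ i, a i i = 0)
    (y : Fin N → ℝ) (i : Fin N) :
    ∑ j, graphLaplacian a i j * y j = ∑ j, a i j * (y i - y j) := by
  have h : ∀ j, graphLaplacian a i j * y j =
      (if i = j then (∑ k, a i k) * y j else 0) - a i j * y j := fun j => by
    by_cases hij : i = j
    · subst hij; simp [graphLaplacian, ha_diag]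
    · simp [graphLaplacian, hij]
  simp only [h, Finset.sum_sub_distrib, mul_sub, Finset.sum_ite_eq, Finset.mem_univ, if_true,
    Finset.sum_mul]

theorem sum_mul_graphLaplacian_eq_zero {N : ℕ} {a : Fin N → Fin N → ℝ} {r : Fin N → ℝ}
    (hr_left : Matrix.vecMul r (graphLaplacian a) = 0) (y : Fin N → ℝ) :
    ∑ i, r i * ∑ j, graphLaplacian a i j * y j = 0 := by
  have := Matrix.dotProduct_mulVec r (graphLaplacian a) y
  rw [hr_left, zero_dotProduct] at this
  exact this

theorem two_mul_sum_mul_graphLaplacian {N : ℕ} {a : Fin N → Fin N → ℝ} (ha_diag : ∀ i, a i i = 0)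
    {r : Fin N → ℝ} (hr_left : Matrix.vecMul r (graphLaplacian a) = 0) (y : Fin N → ℝ) :
    2 * ∑ i, r i * (y i * ∑ j, graphLaplacian a i j * y j) =
      ∑ i, ∑ j, r i * a i j * (y i - y j) ^ 2 := by
  have h := sum_mul_graphLaplacian_eq_zero hr_left fun j => y j ^ 2
  simp only [graphLaplacian_sum_mul a ha_diag] at h ⊢
  rw [← sub_zero (2 * _), ← h, Finset.mul_sum, ← Finset.sum_sub_distrib]
  refine Finset.sum_congr rfl fun i _ => ?_
  simp only [Finset.mul_sum]
  rw [← Finset.sum_sub_distrib]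
  exact Finset.sum_congr rfl fun j _ => by ring

theorem StronglyConnected.exists_sum_sq_sub_le {N : ℕ} {a : Fin N → Fin N → ℝ}
    (ha_nonneg : ∀ i j, 0 ≤ a i j) (hsc : StronglyConnected a) {r : Fin N → ℝ}
    (hr_pos : ∀ i, 0 < r i) (i₀ : Fin N) :
    ∃ K > (0 : ℝ), ∀ y : Fin N → ℝ,
      ∑ i, (y i - y i₀) ^ 2 ≤ K * ∑ i, ∑ j, r i * a i j * (y i - y j) ^ 2 := by
  have hQ : ∀ y : Fin N → ℝ, 0 ≤ ∑ i, ∑ j, r i * a i j * (y i - y j) ^ 2 := fun y =>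
    Finset.sum_nonneg fun i _ => Finset.sum_nonneg fun j _ =>
      mul_nonneg (mul_nonneg (hr_pos i).le (ha_nonneg i j)) (sq_nonneg _)
  have hedge : ∀ u v, 0 < a v u → ∃ K : ℝ, ∀ y : Fin N → ℝ,
      (y v - y u) ^ 2 ≤ K * ∑ i, ∑ j, r i * a i j * (y i - y j) ^ 2 := fun u v h => by
    have hra : 0 < r v * a v u := mul_pos (hr_pos v) h
    refine ⟨(r v * a v u)⁻¹, fun y => (le_inv_mul_iff₀ hra).2 ?_⟩
    have hnn : ∀ i j, 0 ≤ r i * a i j * (y i - y j) ^ 2 := fun i j =>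
      mul_nonneg (mul_nonneg (hr_pos i).le (ha_nonneg i j)) (sq_nonneg _)
    exact (Finset.single_le_sum (f := fun j => r v * a v j * (y v - y j) ^ 2)
      (fun j _ => hnn v j) (Finset.mem_univ u)).trans
      (Finset.single_le_sum (f := fun i => ∑ j, r i * a i j * (y i - y j) ^ 2)
      (fun i _ => Finset.sum_nonneg fun j _ => hnn i j) (Finset.mem_univ v))
  have hpath : ∀ i, ∃ K : ℝ, ∀ y : Fin N → ℝ,
      (y i - y i₀) ^ 2 ≤ K * ∑ i, ∑ j, r i * a i j * (y i - y j) ^ 2 := fun i => by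
    by_cases hi : i₀ = i
    · exact ⟨0, fun y => by simp [hi]⟩
    · induction hsc i₀ i hi with
      | single h => exact hedge _ _ h
      | @tail b c _ h ih =>
        obtain ⟨K₁, h₁⟩ : ∃ K : ℝ, ∀ y : Fin N → ℝ,
            (y b - y i₀) ^ 2 ≤ K * ∑ i, ∑ j, r i * a i j * (y i - y j) ^ 2 := by
          by_cases hb : i₀ = b
          · exact ⟨0, fun y => by simp [hb]⟩
          · exact ih hb
        obtain ⟨K₂, h₂⟩ := hedge _ _ h
        refine ⟨2 * K₁ + 2 * K₂, fun y => ?_⟩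
        nlinarith [h₁ y, h₂ y, sq_nonneg ((y c - y b) - (y b - y i₀))]
  choose K hK using hpath
  obtain ⟨b, hb, h⟩ := exists_pos_forall_le fun _ : Unit => ∑ i, K i
  refine ⟨b, hb, fun y => (Finset.sum_le_sum fun i _ => hK i y).trans ?_⟩
  rw [← Finset.sum_mul]
  exact mul_le_mul_of_nonneg_right (h ()) (hQ y)

theorem le_mul_exp_of_hasDerivAt_le {W W' : ℝ → ℝ} {lam : ℝ}
    (hW : ∀ t, 0 ≤ t → HasDerivAt W (W' t) t) (hW' : ∀ t, 0 ≤ t → W' t ≤ -lam * W t) {t : ℝ}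
    (ht : 0 ≤ t) : W t ≤ W 0 * Real.exp (-lam * t) := by
  have hd : ∀ t, 0 ≤ t → HasDerivAt (fun t => W t * Real.exp (lam * t))
      (W' t * Real.exp (lam * t) + W t * (Real.exp (lam * t) * lam)) t := fun t ht =>
    (hW t ht).mul (by simpa using ((hasDerivAt_id t).const_mul lam).exp)
  have hanti : AntitoneOn (fun t => W t * Real.exp (lam * t)) (Set.Ici 0) := by
    refine antitoneOn_of_hasDerivWithinAt_nonpos (convex_Ici 0)
      (fun t ht => (hd t ht).continuousAt.continuousWithinAt)
      (fun t ht => (hd t (interior_subset ht)).hasDerivWithinAt) fun t ht => ?_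
    have := hW' t (interior_subset ht)
    nlinarith [Real.exp_pos (lam * t)]
  have h := hanti (Set.mem_Ici.2 le_rfl) (Set.mem_Ici.2 ht) ht
  simp only [mul_zero, Real.exp_zero, mul_one] at h
  rw [neg_mul, Real.exp_neg, ← div_eq_mul_inv, le_div_iff₀ (Real.exp_pos _)]
  exact h

theorem dissipation_pointwise {r₀ r α γ η : ℝ} (hr₀ : 0 < r₀) (hr : r₀ ≤ r) (hr1 : r ≤ 1)
    (hη : 0 < η) (y y₀ w v h l : ℝ) :
    α * (y - w) * (-h - γ * (r * l) - r * v) + (y - w + v) * (-h - r * v) ≤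
      -(1 + α) * (y * h) - α * γ * (r * (y * l)) - (1 + α) * y₀ * (r * v) - r₀ / 4 * v ^ 2 +
        (1 / r₀ + 1) * h ^ 2 + η * l ^ 2 + (1 + α) ^ 2 * (y - y₀) ^ 2 +
        (2 * (1 + α) ^ 2 + (α * γ) ^ 2 / (4 * η)) * w ^ 2 := by
  have hr0 : 0 < r := hr₀.trans_le hr
  have e1 : -(v * h) ≤ r₀ / 4 * v ^ 2 + 1 / r₀ * h ^ 2 := by
    have : r₀ / 4 * v ^ 2 + 1 / r₀ * h ^ 2 + v * h = 1 / r₀ * (r₀ / 2 * v + h) ^ 2 := by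
      field_simp; ring
    have : 0 ≤ 1 / r₀ * (r₀ / 2 * v + h) ^ 2 := by positivity
    linarith
  have e2 : -(1 + α) * (r * ((y - y₀) * v)) ≤ r * (v ^ 2 / 4) + (1 + α) ^ 2 * (y - y₀) ^ 2 := by
    nlinarith [mul_nonneg hr0.le (sq_nonneg (v / 2 + (1 + α) * (y - y₀))),
      mul_nonneg (sub_nonneg.2 hr1) (sq_nonneg ((1 + α) * (y - y₀)))]
  have e3 : (1 + α) * (r * (w * v)) ≤ r * (v ^ 2 / 4) + (1 + α) ^ 2 * w ^ 2 := by
    nlinarith [mul_nonneg hr0.le (sq_nonneg (v / 2 - (1 + α) * w)),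
      mul_nonneg (sub_nonneg.2 hr1) (sq_nonneg ((1 + α) * w))]
  have e4 : (1 + α) * (w * h) ≤ h ^ 2 + (1 + α) ^ 2 * w ^ 2 := by
    nlinarith [sq_nonneg (h - (1 + α) * w / 2), sq_nonneg ((1 + α) * w)]
  have e5 : α * γ * r * (w * l) ≤ η * l ^ 2 + (α * γ) ^ 2 / (4 * η) * w ^ 2 := by
    have h1 : η * l ^ 2 + (α * γ) ^ 2 / (4 * η) * (r * w) ^ 2 - α * γ * r * (w * l) =
        η * (l - α * γ * r * w / (2 * η)) ^ 2 := by field_simp; ring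
    have h2 : 0 ≤ η * (l - α * γ * r * w / (2 * η)) ^ 2 := by positivity
    have h3 : (α * γ) ^ 2 / (4 * η) * (r * w) ^ 2 ≤ (α * γ) ^ 2 / (4 * η) * w ^ 2 := by
      refine mul_le_mul_of_nonneg_left ?_ (by positivity)
      rw [mul_pow]
      exact mul_le_of_le_one_left (sq_nonneg w) (pow_le_one₀ hr0.le hr1)
    linarith
  have e6 : r₀ * v ^ 2 ≤ r * v ^ 2 := mul_le_mul_of_nonneg_right hr (sq_nonneg v)
  nlinarith

theorem exists_dissipation {N q : ℕ} {a : Fin N → Fin N → ℝ}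
    (ha_nonneg : ∀ i j, 0 ≤ a i j) (ha_diag : ∀ i, a i i = 0) (hsc : StronglyConnected a)
    {r : Fin N → ℝ} (hr_pos : ∀ i, 0 < r i)
    (hr_left : Matrix.vecMul r (graphLaplacian a) = 0) (hr_le : ∀ i, r i ≤ 1) (i₀ : Fin N)
    {m M : Fin N → ℝ} (hm : ∀ i, 0 < m i) :
    ∃ γ > (0 : ℝ), ∃ α > (0 : ℝ), ∃ ε > (0 : ℝ), ∃ K > (0 : ℝ), ∀ y w v h : Fin N → Fin q → ℝ,
      (∀ s, ∑ i, r i * v i s = 0) →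
      (∀ i, m i * ∑ s, y i s ^ 2 ≤ ∑ s, y i s * h i s) →
      (∀ i, ∑ s, h i s ^ 2 ≤ M i ^ 2 * ∑ s, y i s ^ 2) →
      ∑ i, ∑ s, (α * (y i s - w i s) *
          (-h i s - γ * (r i * ∑ j, graphLaplacian a i j * y j s) - r i * v i s) +
          (y i s - w i s + v i s) * (-h i s - r i * v i s)) ≤
        -ε * (∑ i, ∑ s, y i s ^ 2 + ∑ i, ∑ s, v i s ^ 2) + K * ∑ i, ∑ s, w i s ^ 2 := by
  obtain ⟨r₀, hr₀, hr⟩ := exists_pos_forall_ge r hr_pos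
  obtain ⟨m₀, hm₀, hm'⟩ := exists_pos_forall_ge m hm
  obtain ⟨M₀, hM₀, hM'⟩ := exists_pos_forall_le fun i => M i ^ 2
  obtain ⟨KL, hKL, hL⟩ := exists_sum_sq_mulVec_le (graphLaplacian a)
  obtain ⟨κ, hκ, hκ'⟩ := hsc.exists_sum_sq_sub_le ha_nonneg hr_pos i₀
  set α : ℝ := ((1 / r₀ + 1) * M₀ + 2) / m₀ with hα
  have hα0 : 0 < α := by positivity
  set γ : ℝ := 2 * κ * (1 + α) ^ 2 / α with hγ
  have hγ0 : 0 < γ := by positivity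
  have hαm : α * m₀ = (1 / r₀ + 1) * M₀ + 2 := by rw [hα]; field_simp
  have hαγ : α * γ = 2 * κ * (1 + α) ^ 2 := by rw [hγ]; field_simp
  refine ⟨γ, hγ0, α, hα0, min 1 (r₀ / 4), by positivity,
    2 * (1 + α) ^ 2 + (α * γ) ^ 2 / (4 * KL⁻¹), by positivity, fun y w v h hv hyh hh => ?_⟩
  refine (Finset.sum_le_sum fun i _ => Finset.sum_le_sum fun s _ =>
    dissipation_pointwise (α := α) (γ := γ) hr₀ (hr i) (hr_le i) (inv_pos.2 hKL) (y i s) (y i₀ s)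
      (w i s) (v i s) (h i s) (∑ j, graphLaplacian a i j * y j s)).trans ?_
  simp only [Finset.sum_add_distrib, Finset.sum_sub_distrib, ← Finset.mul_sum]
  have h0 : ∑ i, ∑ s, (1 + α) * y i₀ s * (r i * v i s) = 0 := by
    rw [Finset.sum_comm]
    simp only [← Finset.mul_sum, hv, mul_zero, Finset.sum_const_zero]
  have hYY : 0 ≤ ∑ i, ∑ s, y i s ^ 2 := by positivity
  have hVV : 0 ≤ ∑ i, ∑ s, v i s ^ 2 := by positivity
  have h1 : m₀ * ∑ i, ∑ s, y i s ^ 2 ≤ ∑ i, ∑ s, y i s * h i s := by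
    rw [Finset.mul_sum]
    exact Finset.sum_le_sum fun i _ =>
      (mul_le_mul_of_nonneg_right (hm' i) (by positivity)).trans (hyh i)
  have h2 : ∑ i, ∑ s, h i s ^ 2 ≤ M₀ * ∑ i, ∑ s, y i s ^ 2 := by
    rw [Finset.mul_sum]
    exact Finset.sum_le_sum fun i _ =>
      (hh i).trans (mul_le_mul_of_nonneg_right (hM' i) (by positivity))
  have h3 : ∑ i, ∑ s, (∑ j, graphLaplacian a i j * y j s) ^ 2 ≤ KL * ∑ i, ∑ s, y i s ^ 2 := by
    rw [Finset.sum_comm, Finset.sum_comm (f := fun i s => y i s ^ 2), Finset.mul_sum]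
    exact Finset.sum_le_sum fun s _ => hL fun j => y j s
  have h4 : ∑ i, ∑ s, (y i s - y i₀ s) ^ 2 ≤
      2 * κ * ∑ i, r i * ∑ s, y i s * ∑ j, graphLaplacian a i j * y j s := by
    simp only [Finset.mul_sum (s := (Finset.univ : Finset (Fin q)))]
    rw [Finset.sum_comm, Finset.sum_comm (f := fun i s => r i * _), Finset.mul_sum]
    refine Finset.sum_le_sum fun s _ => (hκ' fun j => y j s).trans (le_of_eq ?_)
    rw [← two_mul_sum_mul_graphLaplacian ha_diag hr_left]
    ring
  have h3' := mul_le_mul_of_nonneg_left h3 (inv_pos.2 hKL).le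
  rw [inv_mul_cancel_left₀ hKL.ne'] at h3'
  have h1' := mul_le_mul_of_nonneg_left h1 (by positivity : 0 ≤ 1 + α)
  have h2' := mul_le_mul_of_nonneg_left h2 (by positivity : 0 ≤ 1 / r₀ + 1)
  have h4' := mul_le_mul_of_nonneg_left h4 (by positivity : 0 ≤ (1 + α) ^ 2)
  have h5 : min 1 (r₀ / 4) * (∑ i, ∑ s, y i s ^ 2) ≤ ∑ i, ∑ s, y i s ^ 2 :=
    mul_le_of_le_one_left hYY (min_le_left _ _)
  have h6 : min 1 (r₀ / 4) * (∑ i, ∑ s, v i s ^ 2) ≤ r₀ / 4 * ∑ i, ∑ s, v i s ^ 2 :=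
    mul_le_mul_of_nonneg_right (min_le_right _ _) hVV
  have h7 : (1 + α) * (m₀ * ∑ i, ∑ s, y i s ^ 2) =
      m₀ * (∑ i, ∑ s, y i s ^ 2) + ((1 / r₀ + 1) * M₀ + 2) * ∑ i, ∑ s, y i s ^ 2 := by
    rw [← hαm]; ring
  have h8 := mul_nonneg hm₀.le hYY
  rw [h0, hαγ]
  linarith

theorem exists_sum_sq_mulVec_le_of_family {ι : Type*} [Fintype ι] {k l : ι → ℕ}
    (A : (i : ι) → Matrix (Fin (k i)) (Fin (l i)) ℝ) :
    ∃ K > (0 : ℝ), ∀ i x, ∑ s, ((A i).mulVec x s) ^ 2 ≤ K * ∑ s, x s ^ 2 := by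
  choose K _ hK using fun i => exists_sum_sq_mulVec_le (A i)
  obtain ⟨b, hb, h⟩ := exists_pos_forall_le K
  exact ⟨b, hb, fun i x => (hK i x).trans (mul_le_mul_of_nonneg_right (h i) (by positivity))⟩

/-- The Lyapunov function of the error system in the coordinates `ξ = x̃ - Ψ ρ̃`, `z = ρ̃`,
`v = ṽ`. -/
noncomputable def errorLyapunov {N q : ℕ} {n : Fin N → ℕ} (r : Fin N → ℝ) (α β : ℝ)
    (B : (i : Fin N) → (Fin (n i) → ℝ) →ₗ[ℝ] (Fin (n i) → ℝ) →ₗ[ℝ] ℝ)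
    (ξ : (i : Fin N) → Fin (n i) → ℝ) (z v : Fin N → Fin q → ℝ) : ℝ :=
  ∑ i, ∑ s, r i * (α / 2 * z i s ^ 2 + 1 / 2 * (z i s + v i s) ^ 2) + β * ∑ i, B i (ξ i) (ξ i)

/-- The squared Euclidean norm of a state of the error system. -/
noncomputable def stateSq {N q : ℕ} {n : Fin N → ℕ} (x : (i : Fin N) → Fin (n i) → ℝ)
    (z v : Fin N → Fin q → ℝ) : ℝ :=
  ∑ i, ∑ s, x i s ^ 2 + ∑ i, ∑ s, z i s ^ 2 + ∑ i, ∑ s, v i s ^ 2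

theorem sum_sum_sq_sub_le {ι : Type*} [Fintype ι] {n : ι → ℕ} (x y : (i : ι) → Fin (n i) → ℝ) :
    ∑ i, ∑ s, (x i s - y i s) ^ 2 ≤ 2 * ∑ i, ∑ s, x i s ^ 2 + 2 * ∑ i, ∑ s, y i s ^ 2 := by
  simp only [Finset.mul_sum, ← Finset.sum_add_distrib]
  exact Finset.sum_le_sum fun i _ => Finset.sum_le_sum fun s _ => by
    nlinarith [sq_nonneg (x i s + y i s)]

theorem exists_errorLyapunov_le {N : ℕ} (q : ℕ) {n : Fin N → ℕ} {r : Fin N → ℝ}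
    (hr_pos : ∀ i, 0 < r i) (hr_le : ∀ i, r i ≤ 1) {α β : ℝ} (hα : 0 < α) (hβ : 0 < β)
    {B : (i : Fin N) → (Fin (n i) → ℝ) →ₗ[ℝ] (Fin (n i) → ℝ) →ₗ[ℝ] ℝ}
    (hB : ∀ i x, ∑ s, x s ^ 2 ≤ B i x x) :
    ∃ K > (0 : ℝ), ∀ (ξ : (i : Fin N) → Fin (n i) → ℝ) (z v : Fin N → Fin q → ℝ),
      errorLyapunov r α β B ξ z v ≤ K * stateSq ξ z v ∧
        stateSq ξ z v ≤ K * errorLyapunov r α β B ξ z v := by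
  obtain ⟨r₀, hr₀, hr⟩ := exists_pos_forall_ge r hr_pos
  choose KB _ hKB using fun i => exists_bilin_self_le (B i)
  obtain ⟨b, hb, hb'⟩ := exists_pos_forall_le KB
  have hlow : ∀ i (z v : ℝ), z ^ 2 + v ^ 2 ≤
      (6 / (α * r₀) + 4 / r₀) * (r i * (α / 2 * z ^ 2 + 1 / 2 * (z + v) ^ 2)) := fun i z v => by
    have h1 : r₀ * (α / 2 * z ^ 2 + 1 / 2 * (z + v) ^ 2) ≤
        r i * (α / 2 * z ^ 2 + 1 / 2 * (z + v) ^ 2) :=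
      mul_le_mul_of_nonneg_right (hr i) (by positivity)
    refine le_trans ?_ (mul_le_mul_of_nonneg_left h1 (by positivity))
    have h2 : (6 / (α * r₀) + 4 / r₀) * (r₀ * (α / 2 * z ^ 2 + 1 / 2 * (z + v) ^ 2)) =
      3 * z ^ 2 + 2 * (z + v) ^ 2 + (3 / α * (z + v) ^ 2 + 2 * α * z ^ 2) := by field_simp; ring
    have h3 : 0 ≤ 3 / α * (z + v) ^ 2 + 2 * α * z ^ 2 := by positivity
    rw [h2]
    nlinarith [sq_nonneg (2 * z + v)]
  have hup : ∀ i (z v : ℝ), r i * (α / 2 * z ^ 2 + 1 / 2 * (z + v) ^ 2) ≤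
      (α / 2 + 1) * (z ^ 2 + v ^ 2) := fun i z v => by
    refine (mul_le_of_le_one_left (by positivity) (hr_le i)).trans ?_
    nlinarith [sq_nonneg (z - v), mul_nonneg hα.le (sq_nonneg v)]
  set T₁ : ℝ := 6 / (α * r₀) + 4 / r₀
  have hT₁ : 0 < T₁ := by positivity
  refine ⟨α / 2 + 1 + β * b + T₁ + β⁻¹, by positivity, fun ξ z v => ?_⟩
  have hX : 0 ≤ ∑ i, ∑ s, ξ i s ^ 2 := by positivity
  have hZV : 0 ≤ ∑ i, ∑ s, (z i s ^ 2 + v i s ^ 2) := by positivity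
  have hS : stateSq ξ z v = ∑ i, ∑ s, ξ i s ^ 2 + ∑ i, ∑ s, (z i s ^ 2 + v i s ^ 2) := by
    simp only [stateSq, Finset.sum_add_distrib]; ring
  have hBX : ∑ i, ∑ s, ξ i s ^ 2 ≤ ∑ i, B i (ξ i) (ξ i) := Finset.sum_le_sum fun i _ => hB i _
  have hXB : ∑ i, B i (ξ i) (ξ i) ≤ b * ∑ i, ∑ s, ξ i s ^ 2 := by
    rw [Finset.mul_sum]
    exact Finset.sum_le_sum fun i _ =>
      (hKB i _).trans (mul_le_mul_of_nonneg_right (hb' i) (by positivity))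
  have hup' : ∑ i, ∑ s, r i * (α / 2 * z i s ^ 2 + 1 / 2 * (z i s + v i s) ^ 2) ≤
      (α / 2 + 1) * ∑ i, ∑ s, (z i s ^ 2 + v i s ^ 2) := by
    simp only [Finset.mul_sum (a := α / 2 + 1)]
    exact Finset.sum_le_sum fun i _ => Finset.sum_le_sum fun s _ => hup i _ _
  have hlow' : ∑ i, ∑ s, (z i s ^ 2 + v i s ^ 2) ≤
      T₁ * ∑ i, ∑ s, r i * (α / 2 * z i s ^ 2 + 1 / 2 * (z i s + v i s) ^ 2) := by
    simp only [Finset.mul_sum (a := T₁)]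
    exact Finset.sum_le_sum fun i _ => Finset.sum_le_sum fun s _ => hlow i _ _
  rw [hS, errorLyapunov]
  set Z := ∑ i, ∑ s, (z i s ^ 2 + v i s ^ 2)
  set X := ∑ i, ∑ s, ξ i s ^ 2
  set P := ∑ i, ∑ s, r i * (α / 2 * z i s ^ 2 + 1 / 2 * (z i s + v i s) ^ 2)
  set Y := ∑ i, B i (ξ i) (ξ i)
  have hP : 0 ≤ P := by
    by_contra h
    nlinarith
  have hβY : β⁻¹ * (β * Y) = Y := inv_mul_cancel_left₀ hβ.ne' Y
  have hY : 0 ≤ β * Y := mul_nonneg hβ.le (hX.trans hBX)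
  have g1 := mul_le_mul_of_nonneg_left hXB hβ.le
  have hβi : 0 ≤ β⁻¹ := by positivity
  have hβb : 0 ≤ β * b := by positivity
  constructor
  · nlinarith [mul_nonneg hT₁.le hX, mul_nonneg hT₁.le hZV, mul_nonneg hβi hX, mul_nonneg hβi hZV,
      mul_nonneg hα.le hX, mul_nonneg hβb hZV]
  · nlinarith [mul_nonneg hT₁.le hY, mul_nonneg hβi hP, mul_nonneg hα.le hP, mul_nonneg hα.le hY,
      mul_nonneg hβb hP, mul_nonneg hβb hY]

theorem exists_stateSq_sub_mulVec_le {N q : ℕ} {n : Fin N → ℕ}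
    (Ψ : (i : Fin N) → Matrix (Fin (n i)) (Fin q) ℝ) :
    ∃ K > (0 : ℝ), ∀ (x : (i : Fin N) → Fin (n i) → ℝ) (z v : Fin N → Fin q → ℝ),
      stateSq x z v ≤ K * stateSq (fun i => x i - (Ψ i).mulVec (z i)) z v ∧
        stateSq (fun i => x i - (Ψ i).mulVec (z i)) z v ≤ K * stateSq x z v := by
  obtain ⟨K, hK, h⟩ := exists_sum_sq_mulVec_le_of_family Ψ
  refine ⟨2 + 2 * K, by positivity, fun x z v => ?_⟩
  have hZ : ∑ i, ∑ s, ((Ψ i).mulVec (z i)) s ^ 2 ≤ K * ∑ i, ∑ s, z i s ^ 2 := by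
    rw [Finset.mul_sum]
    exact Finset.sum_le_sum fun i _ => h i _
  have h1 := sum_sum_sq_sub_le x fun i => (Ψ i).mulVec (z i)
  have h2 := sum_sum_sq_sub_le (fun i => x i - (Ψ i).mulVec (z i)) fun i => -(Ψ i).mulVec (z i)
  simp only [Pi.sub_apply, Pi.neg_apply, sub_neg_eq_add, sub_add_cancel, neg_sq] at h2
  have hX : 0 ≤ ∑ i, ∑ s, x i s ^ 2 := by positivity
  have hX' : 0 ≤ ∑ i, ∑ s, (x i s - ((Ψ i).mulVec (z i)) s) ^ 2 := by positivity
  have hZ' : 0 ≤ ∑ i, ∑ s, z i s ^ 2 := by positivity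
  have hV : 0 ≤ ∑ i, ∑ s, v i s ^ 2 := by positivity
  simp only [stateSq, Pi.sub_apply]
  constructor <;> nlinarith [mul_nonneg hK.le hX, mul_nonneg hK.le hX', mul_nonneg hK.le hV]

theorem sqrt_add_sqrt_add_sqrt_le_of_sum_le {a b c a₀ b₀ c₀ K lam t : ℝ} (ha : 0 ≤ a) (hb : 0 ≤ b)
    (hc : 0 ≤ c) (ha₀ : 0 ≤ a₀) (hb₀ : 0 ≤ b₀) (hc₀ : 0 ≤ c₀) (hK : 0 ≤ K)
    (h : a + b + c ≤ K * (a₀ + b₀ + c₀) * Real.exp (-lam * t)) :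
    √a + √b + √c ≤ √(3 * K) * (√a₀ + √b₀ + √c₀) * Real.exp (-(lam / 2) * t) := by
  have he : Real.exp (-lam * t) = Real.exp (-(lam / 2) * t) ^ 2 := by
    rw [← Real.exp_nat_mul]; congr 1; push_cast; ring
  have e := Real.exp_pos (-(lam / 2) * t)
  rw [he] at h
  refine abs_le_of_sq_le_sq' ?_ (by positivity) |>.2
  have hsum : a₀ + b₀ + c₀ ≤ (√a₀ + √b₀ + √c₀) ^ 2 := by
    nlinarith [Real.sq_sqrt ha₀, Real.sq_sqrt hb₀, Real.sq_sqrt hc₀,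
      mul_nonneg (Real.sqrt_nonneg a₀) (Real.sqrt_nonneg b₀),
      mul_nonneg (Real.sqrt_nonneg a₀) (Real.sqrt_nonneg c₀),
      mul_nonneg (Real.sqrt_nonneg b₀) (Real.sqrt_nonneg c₀)]
  calc (√a + √b + √c) ^ 2 ≤ 3 * (a + b + c) := by
        nlinarith [Real.sq_sqrt ha, Real.sq_sqrt hb, Real.sq_sqrt hc, sq_nonneg (√a - √b),
          sq_nonneg (√a - √c), sq_nonneg (√b - √c)]
    _ ≤ 3 * (K * (a₀ + b₀ + c₀) * Real.exp (-(lam / 2) * t) ^ 2) := by gcongr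
    _ ≤ 3 * (K * (√a₀ + √b₀ + √c₀) ^ 2 * Real.exp (-(lam / 2) * t) ^ 2) := by gcongr
    _ = _ := by
        rw [mul_pow, mul_pow, Real.sq_sqrt (by positivity)]; ring

theorem HasDerivAt.bilin {E : Type*} [NormedAddCommGroup E] [NormedSpace ℝ E]
    [FiniteDimensional ℝ E] (B : E →ₗ[ℝ] E →ₗ[ℝ] ℝ) {u v : ℝ → E} {u' v' : E} {t : ℝ}
    (hu : HasDerivAt u u' t) (hv : HasDerivAt v v' t) :
    HasDerivAt (fun t => B (u t) (v t)) (B (u t) v' + B u' (v t)) t :=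
  B.toContinuousBilinearMap.hasDerivAt_of_bilinear (fun _ => hu) fun _ => hv

theorem HasDerivAt.matrix_mulVec {k l : ℕ} (A : Matrix (Fin k) (Fin l) ℝ) {u : ℝ → Fin l → ℝ}
    {u' : Fin l → ℝ} {t : ℝ} (hu : HasDerivAt u u' t) :
    HasDerivAt (fun t => A.mulVec (u t)) (A.mulVec u') t :=
  A.mulVecLin.toContinuousLinearMap.hasFDerivAt.comp_hasDerivAt t hu

theorem exists_sum_bilin_decay {N : ℕ} {n : Fin N → ℕ}
    {Ac : (i : Fin N) → Matrix (Fin (n i)) (Fin (n i)) ℝ} (hAc : ∀ i, IsHurwitz (Ac i)) :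
    ∃ B : (i : Fin N) → (Fin (n i) → ℝ) →ₗ[ℝ] (Fin (n i) → ℝ) →ₗ[ℝ] ℝ, ∃ c > (0 : ℝ),
      (∀ i x, ∑ s, x s ^ 2 ≤ B i x x) ∧ ∀ x : (i : Fin N) → Fin (n i) → ℝ,
        ∑ i, (B i (x i) ((Ac i).mulVec (x i)) + B i ((Ac i).mulVec (x i)) (x i)) ≤
          -c * ∑ i, ∑ s, x i s ^ 2 := by
  choose B c hc hB hd using fun i => (hAc i).exists_lyapunov_form
  obtain ⟨c₀, hc₀, h⟩ := exists_pos_forall_ge c hc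
  refine ⟨B, c₀, hc₀, hB, fun x => ?_⟩
  rw [Finset.mul_sum]
  refine Finset.sum_le_sum fun i _ => ?_
  have h1 := mul_le_mul_of_nonneg_right (h i) (by positivity : 0 ≤ ∑ s, x i s ^ 2)
  linarith [hd i (x i)]

theorem hasDerivAt_errorLyapunov {N q : ℕ} {n : Fin N → ℕ} (r : Fin N → ℝ) (α β : ℝ)
    (B : (i : Fin N) → (Fin (n i) → ℝ) →ₗ[ℝ] (Fin (n i) → ℝ) →ₗ[ℝ] ℝ)
    {ξ : (i : Fin N) → ℝ → Fin (n i) → ℝ} {z v : Fin N → ℝ → Fin q → ℝ}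
    {ξ' : (i : Fin N) → Fin (n i) → ℝ} {z' v' : Fin N → Fin q → ℝ} {t : ℝ}
    (hξ : ∀ i, HasDerivAt (ξ i) (ξ' i) t) (hz : ∀ i, HasDerivAt (z i) (z' i) t)
    (hv : ∀ i, HasDerivAt (v i) (v' i) t) :
    HasDerivAt (fun t => errorLyapunov r α β B (fun i => ξ i t) (fun i => z i t) fun i => v i t)
      (∑ i, ∑ s, (α * z i t s * (r i * z' i s) +
          (z i t s + v i t s) * (r i * z' i s + r i * v' i s)) +
        β * ∑ i, (B i (ξ i t) (ξ' i) + B i (ξ' i) (ξ i t))) t := by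
  refine HasDerivAt.add ?_ ((HasDerivAt.fun_sum fun i _ =>
    HasDerivAt.bilin (B i) (hξ i) (hξ i)).const_mul β)
  refine HasDerivAt.fun_sum fun i _ => HasDerivAt.fun_sum fun s _ => ?_
  have h1 := hasDerivAt_pi.1 (hz i) s
  have h2 := hasDerivAt_pi.1 (hv i) s
  refine ((((h1.pow 2).const_mul (α / 2)).add
    (((h1.add h2).pow 2).const_mul (1 / 2))).const_mul (r i)).congr_deriv ?_
  simp only [Pi.add_apply]
  ring

/-- A weighted sum whose derivative is a multiple of `rᵀ L y` is conserved. -/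
theorem sum_mul_eq_zero_of_hasDerivAt {N : ℕ} {a : Fin N → Fin N → ℝ} {r : Fin N → ℝ}
    (hr_left : Matrix.vecMul r (graphLaplacian a) = 0) {γ : ℝ} {v y : ℝ → Fin N → ℝ}
    (hv : ∀ i t, 0 ≤ t →
      HasDerivAt (fun t => v t i) (γ * ∑ j, graphLaplacian a i j * y t j) t)
    (h0 : ∑ i, r i * v 0 i = 0) {t : ℝ} (ht : 0 ≤ t) : ∑ i, r i * v t i = 0 := by
  have hd : ∀ t, 0 ≤ t → HasDerivAt (fun t => ∑ i, r i * v t i) 0 t := fun t ht => by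
    refine (HasDerivAt.fun_sum fun i _ => (hv i t ht).const_mul (r i)).congr_deriv ?_
    have := sum_mul_graphLaplacian_eq_zero hr_left (y t)
    simp only [mul_left_comm _ γ, ← Finset.mul_sum] at this ⊢
    rw [this, mul_zero]
  rw [← h0]
  exact constant_of_has_deriv_right_zero (f := fun t => ∑ i, r i * v t i)
    (fun s hs => (hd s hs.1).continuousAt.continuousWithinAt)
    (fun s hs => (hd s hs.1).hasDerivWithinAt) t (Set.right_mem_Icc.2 ht)

/-- Exponential stability of the error system (13) (Step 1 of the proof of
Theorem 1 of the paper). -/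
theorem error_system_exponentially_stable
    (N q : ℕ) (hN : 2 ≤ N) (a : Fin N → Fin N → ℝ)
    (ha_nonneg : ∀ i j, 0 ≤ a i j) (ha_diag : ∀ i, a i i = 0)
    (hsc : StronglyConnected a)
    (r : Fin N → ℝ) (hr_pos : ∀ i, 0 < r i)
    (hr_left : Matrix.vecMul r (graphLaplacian a) = 0)
    (hr_sum : ∑ i, r i = 1)
    (n : Fin N → ℕ)
    (C : (i : Fin N) → Matrix (Fin q) (Fin (n i)) ℝ)
    (Ψ : (i : Fin N) → Matrix (Fin (n i)) (Fin q) ℝ)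
    (hCΨ : ∀ i, C i * Ψ i = 1)
    (Ac : (i : Fin N) → Matrix (Fin (n i)) (Fin (n i)) ℝ)
    (hAc : ∀ i, IsHurwitz (Ac i))
    (f : Fin N → (Fin q → ℝ) → ℝ) (m M : Fin N → ℝ)
    (hm : ∀ i, 0 < m i) (hM : ∀ i, 0 < M i)
    (hC1 : ∀ i, ContDiff ℝ 1 (f i))
    (hconv : ∀ i, StronglyConvexWith (m i) (f i))
    (hlip : ∀ i, GradLipschitzWith (M i) (f i))
    (xbar : (i : Fin N) → Fin (n i) → ℝ) :
    ∃ γ₁ > (0 : ℝ), ∃ γ₂ > (0 : ℝ),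
      ∀ (xt : (i : Fin N) → ℝ → Fin (n i) → ℝ)
        (ρt vt : Fin N → ℝ → Fin q → ℝ),
        -- `h i t = ∇fᵢ(Cᵢ(x̄ᵢ + x̃ᵢ(t))) − ∇fᵢ(Cᵢ x̄ᵢ)` and
        -- `ρdot i t` is the right-hand side of the `ρ̃`-equation
        (∀ i : Fin N, ∀ t : ℝ, 0 ≤ t →
          (HasDerivAt (xt i)
            ((Ac i).mulVec (xt i t - (Ψ i).mulVec (ρt i t)) +
              (Ψ i).mulVec (fun s =>
                -(r i)⁻¹ * (grad (f i) ((C i).mulVec (xbar i + xt i t)) s -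
                    grad (f i) ((C i).mulVec (xbar i)) s) -
                  γ₁ * ∑ j, graphLaplacian a i j * ((C j).mulVec (xt j t)) s -
                  γ₂ * vt i t s)) t) ∧
          (HasDerivAt (ρt i)
            (fun s =>
              -(r i)⁻¹ * (grad (f i) ((C i).mulVec (xbar i + xt i t)) s -
                  grad (f i) ((C i).mulVec (xbar i)) s) -
                γ₁ * ∑ j, graphLaplacian a i j * ((C j).mulVec (xt j t)) s -
                γ₂ * vt i t s) t) ∧
          (HasDerivAt (vt i)
            (fun s =>
              γ₁ * ∑ j, graphLaplacian a i j * ((C j).mulVec (xt j t)) s) t)) →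
        -- `(rᵀ ⊗ I_q) ṽ(0) = 0`
        (∀ s : Fin q, ∑ i, r i * vt i 0 s = 0) →
        ∃ c > (0 : ℝ), ∃ lam > (0 : ℝ), ∀ t : ℝ, 0 ≤ t →
          Real.sqrt (∑ i, ∑ s, (xt i t s) ^ 2) +
              Real.sqrt (∑ i, ∑ s, (ρt i t s) ^ 2) +
              Real.sqrt (∑ i, ∑ s, (vt i t s) ^ 2) ≤
            c * (Real.sqrt (∑ i, ∑ s, (xt i 0 s) ^ 2) +
                  Real.sqrt (∑ i, ∑ s, (ρt i 0 s) ^ 2) +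
                  Real.sqrt (∑ i, ∑ s, (vt i 0 s) ^ 2)) *
              Real.exp (-lam * t) := by
  have hr_le : ∀ i, r i ≤ 1 := fun i =>
    hr_sum ▸ Finset.single_le_sum (fun j _ => (hr_pos j).le) (Finset.mem_univ i)
  obtain ⟨γ, hγ, α, hα, ε, hε, K, hK, hdiss⟩ := exists_dissipation (q := q) ha_nonneg ha_diag hsc
    hr_pos hr_left hr_le ⟨0, by omega⟩ (M := M) hm
  obtain ⟨KC, hKC, hC⟩ := exists_sum_sq_mulVec_le_of_family C
  obtain ⟨B, c, hc, hB, hBd⟩ := exists_sum_bilin_decay hAc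
  set β : ℝ := (K * KC + ε * (1 + KC)) / c with hβ
  have hβ0 : 0 < β := by positivity
  have hβc : β * c = K * KC + ε * (1 + KC) := by rw [hβ]; field_simp
  obtain ⟨K₁, hK₁, hV⟩ := exists_errorLyapunov_le q hr_pos hr_le hα hβ0 hB
  obtain ⟨K₂, hK₂, hS⟩ := exists_stateSq_sub_mulVec_le Ψ
  refine ⟨γ, hγ, 1, one_pos, fun xt ρt vt hsol hv0 => ?_⟩
  set ξ : (i : Fin N) → ℝ → Fin (n i) → ℝ := fun i t => xt i t - (Ψ i).mulVec (ρt i t) with hξ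
  have hξd : ∀ i t, 0 ≤ t → HasDerivAt (ξ i) ((Ac i).mulVec (ξ i t)) t := fun i t ht => by
    obtain ⟨h1, h2, -⟩ := hsol i t ht
    exact (h1.sub (h2.matrix_mulVec (Ψ i))).congr_deriv (by simp [hξ])
  have hvz : ∀ t, 0 ≤ t → ∀ s, ∑ i, r i * vt i t s = 0 := fun t ht s =>
    sum_mul_eq_zero_of_hasDerivAt hr_left (v := fun t i => vt i t s)
      (y := fun t j => ((C j).mulVec (xt j t)) s)
      (fun i t ht => hasDerivAt_pi.1 (hsol i t ht).2.2 s) (hv0 s) ht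
  have hCξ : ∀ i t s, ((C i).mulVec (ξ i t)) s = ((C i).mulVec (xt i t)) s - ρt i t s :=
    fun i t s => by simp [hξ, Matrix.mulVec_sub, Matrix.mulVec_mulVec, hCΨ]
  have hVd := fun t ht => hasDerivAt_errorLyapunov r α β B (fun i => hξd i t ht)
    (fun i => (hsol i t ht).2.1) (fun i => (hsol i t ht).2.2)
  have hdecay := fun t ht => le_mul_exp_of_hasDerivAt_le (lam := ε / (2 * K₁)) (t := t) hVd
    (fun t ht => ?_) ht
  · refine ⟨√(3 * (K₂ * K₁ * (K₁ * K₂))), by positivity, ε / (2 * K₁) / 2, by positivity,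
      fun t ht => ?_⟩
    refine sqrt_add_sqrt_add_sqrt_le_of_sum_le (by positivity) (by positivity) (by positivity)
      (by positivity) (by positivity) (by positivity) (by positivity) ?_
    calc stateSq (fun i => xt i t) (fun i => ρt i t) (fun i => vt i t)
        ≤ K₂ * stateSq (fun i => ξ i t) (fun i => ρt i t) (fun i => vt i t) := (hS _ _ _).1
      _ ≤ K₂ * (K₁ * errorLyapunov r α β B (fun i => ξ i t) (fun i => ρt i t) fun i => vt i t) := by
          gcongr; exact (hV _ _ _).2
      _ ≤ K₂ * (K₁ * (errorLyapunov r α β B (fun i => ξ i 0) (fun i => ρt i 0) (fun i => vt i 0) *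
            Real.exp (-(ε / (2 * K₁)) * t))) := by
          gcongr; exact hdecay t ht
      _ ≤ K₂ * (K₁ * (K₁ * (K₂ * stateSq (fun i => xt i 0) (fun i => ρt i 0) fun i => vt i 0) *
            Real.exp (-(ε / (2 * K₁)) * t))) := by
          gcongr
          exact (hV _ _ _).1.trans (mul_le_mul_of_nonneg_left (hS _ _ _).2 hK₁.le)
      _ = _ := by rw [stateSq]; ring
  · set y : Fin N → Fin q → ℝ := fun i => (C i).mulVec (xt i t) with hy
    set w : Fin N → Fin q → ℝ := fun i => (C i).mulVec (ξ i t) with hw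
    set h : Fin N → Fin q → ℝ := fun i s => grad (f i) ((C i).mulVec (xbar i + xt i t)) s -
      grad (f i) ((C i).mulVec (xbar i)) s with hh
    have hyd : ∀ i s, ((C i).mulVec (xbar i + xt i t)) s - ((C i).mulVec (xbar i)) s = y i s :=
      fun i s => by simp [hy, Matrix.mulVec_add]
    have hyh : ∀ i, m i * ∑ s, y i s ^ 2 ≤ ∑ s, y i s * h i s := fun i => by
      simpa only [hyd] using hconv i ((C i).mulVec (xbar i + xt i t)) ((C i).mulVec (xbar i))
    have hhh : ∀ i, ∑ s, h i s ^ 2 ≤ M i ^ 2 * ∑ s, y i s ^ 2 := fun i => by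
      simpa only [hyd] using hlip i ((C i).mulVec (xbar i + xt i t)) ((C i).mulVec (xbar i))
    have hz : ∀ i s, ρt i t s = y i s - w i s := fun i s => by simp only [hw, hCξ, hy]; ring
    have h1 := hdiss y w (fun i => vt i t) h (hvz t ht) hyh hhh
    have h2 := mul_le_mul_of_nonneg_left (hBd fun i => ξ i t) hβ0.le
    have hww : ∑ i, ∑ s, w i s ^ 2 ≤ KC * ∑ i, ∑ s, ξ i t s ^ 2 := by
      rw [Finset.mul_sum]
      exact Finset.sum_le_sum fun i _ => hC i _
    have hzz : ∑ i, ∑ s, ρt i t s ^ 2 ≤ 2 * ∑ i, ∑ s, y i s ^ 2 + 2 * ∑ i, ∑ s, w i s ^ 2 := by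
      simp only [hz]
      exact sum_sum_sq_sub_le y w
    have hle : ε / 2 * stateSq (fun i => ξ i t) (fun i => ρt i t) (fun i => vt i t) ≤
        ε * (∑ i, ∑ s, y i s ^ 2 + ∑ i, ∑ s, vt i t s ^ 2 + (1 + KC) * ∑ i, ∑ s, ξ i t s ^ 2) := by
      have hx0 : 0 ≤ ∑ i, ∑ s, ξ i t s ^ 2 := by positivity
      have hv0 : 0 ≤ ∑ i, ∑ s, vt i t s ^ 2 := by positivity
      rw [div_mul_eq_mul_div, mul_div_assoc]
      refine mul_le_mul_of_nonneg_left ?_ hε.le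
      rw [stateSq]
      linarith
    have hVle : ε / (2 * K₁) *
        errorLyapunov r α β B (fun i => ξ i t) (fun i => ρt i t) (fun i => vt i t) ≤
        ε / 2 * stateSq (fun i => ξ i t) (fun i => ρt i t) (fun i => vt i t) := by
      refine (mul_le_mul_of_nonneg_left (hV _ _ _).1 (by positivity)).trans (le_of_eq ?_)
      field_simp
    have hsum : ∑ i, ∑ s, (α * (y i s - w i s) *
          (-h i s - γ * (r i * ∑ j, graphLaplacian a i j * y j s) - r i * vt i t s) +
          (y i s - w i s + vt i t s) * (-h i s - r i * vt i t s)) =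
        ∑ i, ∑ s, (α * ρt i t s * (r i * (-(r i)⁻¹ * h i s -
            γ * ∑ j, graphLaplacian a i j * y j s - 1 * vt i t s)) +
          (ρt i t s + vt i t s) * (r i * (-(r i)⁻¹ * h i s -
            γ * ∑ j, graphLaplacian a i j * y j s - 1 * vt i t s) +
            r i * (γ * ∑ j, graphLaplacian a i j * y j s))) := by
      refine Finset.sum_congr rfl fun i _ => Finset.sum_congr rfl fun s _ => ?_
      have hri := mul_inv_cancel₀ (hr_pos i).ne'
      rw [hz]
      linear_combination (α * (y i s - w i s) * h i s + (y i s - w i s + vt i t s) * h i s) * hri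
    rw [hsum] at h1
    have hKw := mul_le_mul_of_nonneg_left hww hK.le
    have hβX : β * (-c * ∑ i, ∑ s, ξ i t s ^ 2) =
        -((K * KC + ε * (1 + KC)) * ∑ i, ∑ s, ξ i t s ^ 2) := by rw [← hβc]; ring
    refine (add_le_add h1 h2).trans ?_
    linarith
end

section
/- (Theorem 1, state feedback.) Under the multi-agent setup below, there exist positive constants γ₁ and γ₂ such that the following holds. Let x_i : [0,∞) → ℝ^{n_i}, ρ_i, v_i : [0,∞) → ℝ^q and z_i : [0,∞) → ℝ^N be differentiable functions with v_i(0) = 0 and z_i(0) = e_i (the i-th standard basis vector of ℝ^N), satisfying for all t ≥ 0 and all i = 1,…,N (writing y_i = C_i x_i, z_i^i for the i-th component of z_i, and ω_i = −∇f_i(y_i)/z_i^i − γ₁ Σ_{j=1}^N a_{ij}(y_i − y_j) − γ₂ v_i): ẋ_i = A_i x_i + B_i(−K_i x_i + Υ_i ω_i − (Φ_i − K_iΨ_i) ρ_i), ρ̇_i = ω_i, v̇_i = γ₁ Σ_{j=1}^N a_{ij}(y_i − y_j), ż_i = −Σ_{j=1}^N a_{ij}(z_i − z_j). Then z_i^i(t)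 > 0 for all t ≥ 0 (so the controller is well defined), and y_i(t) converges exponentially to y*: there exist c, λ > 0 such that ∥y_i(t) − y*∥ ≤ c e^{−λ t} for all t ≥ 0 and all i, where y* is the unique minimizer of Σ_{j=1}^N f_j over ℝ^q. -/
open Matrix Finset

/-- The Laplacian of the weighted digraph `a`, acting on node functions. -/
def lap {N : ℕ} (a : Fin N → Fin N → ℝ) (u : Fin N → ℝ) (i : Fin N) : ℝ :=
  ∑ j, a i j * (u i - u j)

/-- `r` is a left null vector of the Laplacian of `a`. -/
def IsBalancing {N : ℕ} (a : Fin N → Fin N → ℝ) (r : Fin N → ℝ) : Prop :=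
  ∀ j, ∑ i, r i * a i j = r j * ∑ k, a j k

lemma IsBalancing.abs {N : ℕ} {a : Fin N → Fin N → ℝ} (ha : ∀ i j, 0 ≤ a i j)
    {r : Fin N → ℝ} (hr : IsBalancing a r) : IsBalancing a (fun i => |r i|) := by
  have hle : ∀ j ∈ univ, |r j| * ∑ k, a j k ≤ ∑ i, |r i| * a i j := by
    intro j _
    have hd : 0 ≤ ∑ k, a j k := sum_nonneg fun k _ => ha j k
    calc |r j| * ∑ k, a j k = |∑ i, r i * a i j| := by rw [hr j, abs_mul, abs_of_nonneg hd]
      _ ≤ ∑ i, |r i * a i j| := abs_sum_le_sum_abs _ _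
      _ = ∑ i, |r i| * a i j := by simp only [abs_mul, abs_of_nonneg (ha _ _)]
  have hsum : ∑ j, |r j| * ∑ k, a j k = ∑ j, ∑ i, |r i| * a i j := by
    rw [sum_comm]
    simp only [mul_sum]
  intro j
  exact ((sum_eq_sum_iff_of_le hle).1 hsum j (mem_univ j)).symm

lemma exists_isBalancing_ne_zero {N : ℕ} (hN : 0 < N) (a : Fin N → Fin N → ℝ) :
    ∃ r : Fin N → ℝ, r ≠ 0 ∧ IsBalancing a r := by
  let L : Matrix (Fin N) (Fin N) ℝ := diagonal (fun i => ∑ k, a i k) - of a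
  have hdet : L.det = 0 := by
    refine Matrix.exists_mulVec_eq_zero_iff.1 ⟨fun _ => 1, ?_, ?_⟩
    · intro h
      exact one_ne_zero (congrFun h ⟨0, hN⟩)
    · ext i
      rw [sub_mulVec, Pi.sub_apply, mulVec_diagonal]
      simp [mulVec, dotProduct]
  obtain ⟨r, hr0, hr⟩ := Matrix.exists_vecMul_eq_zero_iff.2 hdet
  refine ⟨r, hr0, fun j => ?_⟩
  have h := congrFun hr j
  rw [vecMul_sub, Pi.sub_apply, vecMul_diagonal] at h
  simp only [vecMul, dotProduct, of_apply, Pi.zero_apply] at h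
  linarith

lemma IsBalancing.eq_zero_of_transGen {N : ℕ} {a : Fin N → Fin N → ℝ}
    (ha : ∀ i j, 0 ≤ a i j) {r : Fin N → ℝ} (hr : IsBalancing a r) (hr0 : ∀ i, 0 ≤ r i)
    {i j : Fin N} (hij : Relation.TransGen (fun u v : Fin N => 0 < a v u) i j)
    (hi : r i = 0) : r j = 0 := by
  have step : ∀ k l : Fin N, 0 < a l k → r k = 0 → r l = 0 := by
    intro k l hkl hk
    have h := hr k
    rw [hk, zero_mul, sum_eq_zero_iff_of_nonneg fun i _ => mul_nonneg (hr0 i) (ha i k)] at h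
    exact (mul_eq_zero.1 (h l (mem_univ l))).resolve_right hkl.ne'
  induction hij with
  | single h => exact step _ _ h hi
  | tail _ h ih => exact step _ _ h ih

/-- Perron–Frobenius for Laplacians of strongly connected digraphs. -/
lemma exists_pos_isBalancing {N : ℕ} (hN : 0 < N) {a : Fin N → Fin N → ℝ}
    (ha : ∀ i j, 0 ≤ a i j) (hsc : StronglyConnected a) :
    ∃ r : Fin N → ℝ, (∀ i, 0 < r i) ∧ ∑ i, r i = 1 ∧ IsBalancing a r := by
  obtain ⟨r, hr0, hr⟩ := exists_isBalancing_ne_zero hN a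
  have hpos : ∀ i, 0 < |r i| := by
    by_contra! h
    obtain ⟨i, hi⟩ := h
    have hi0 : |r i| = 0 := le_antisymm hi (abs_nonneg _)
    refine hr0 (funext fun j => ?_)
    by_cases hij : i = j
    · exact hij ▸ abs_eq_zero.1 hi0
    · exact abs_eq_zero.1
        ((hr.abs ha).eq_zero_of_transGen ha (fun k => abs_nonneg (r k)) (hsc i j hij) hi0)
  have hS : 0 < ∑ i, |r i| := sum_pos (fun i _ => hpos i) ⟨⟨0, hN⟩, mem_univ _⟩
  refine ⟨fun i => |r i| / ∑ k, |r k|, fun i => div_pos (hpos i) hS, ?_, fun j => ?_⟩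
  · rw [← sum_div, div_self hS.ne']
  · have h := hr.abs ha j
    simp only [div_mul_eq_mul_div, ← sum_div]
    rw [h]

lemma IsBalancing.sum_mul_lap {N : ℕ} {a : Fin N → Fin N → ℝ} {r : Fin N → ℝ}
    (hr : IsBalancing a r) (u : Fin N → ℝ) : ∑ i, r i * lap a u i = 0 := by
  have h : ∑ i, ∑ j, r i * a i j * u j = ∑ i, ∑ j, r i * a i j * u i := by
    rw [sum_comm]
    refine sum_congr rfl fun j _ => ?_
    rw [← sum_mul, hr j, mul_sum, sum_mul]
  simp only [lap, mul_sum, mul_sub, sum_sub_distrib, ← mul_assoc]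
  rw [h, sub_self]

lemma IsBalancing.sum_mul_mul_lap {N : ℕ} {a : Fin N → Fin N → ℝ} {r : Fin N → ℝ}
    (hr : IsBalancing a r) (u : Fin N → ℝ) :
    2 * ∑ i, r i * (u i * lap a u i) = ∑ i, ∑ j, r i * a i j * (u i - u j) ^ 2 := by
  have h := hr.sum_mul_lap fun i => u i ^ 2
  rw [← sub_zero (2 * _), ← h, mul_sum, ← sum_sub_distrib]
  refine sum_congr rfl fun i _ => ?_
  simp only [lap, mul_sum, ← sum_sub_distrib]
  exact sum_congr rfl fun j _ => by ring

lemma exists_sq_sub_le_of_transGen {N : ℕ} {a : Fin N → Fin N → ℝ}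
    (ha : ∀ i j, 0 ≤ a i j) {r : Fin N → ℝ} (hr : ∀ i, 0 < r i)
    {i j : Fin N} (hij : Relation.TransGen (fun u v : Fin N => 0 < a v u) i j) :
    ∃ c : ℝ, 0 ≤ c ∧ ∀ u : Fin N → ℝ,
      (u i - u j) ^ 2 ≤ c * ∑ k, ∑ l, r k * a k l * (u k - u l) ^ 2 := by
  have step : ∀ k l : Fin N, 0 < a l k → ∃ c : ℝ, 0 ≤ c ∧ ∀ u : Fin N → ℝ,
      (u k - u l) ^ 2 ≤ c * ∑ k, ∑ l, r k * a k l * (u k - u l) ^ 2 := by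
    intro k l hkl
    have hp : 0 < r l * a l k := mul_pos (hr l) hkl
    refine ⟨(r l * a l k)⁻¹, (inv_pos.2 hp).le, fun u => ?_⟩
    have hnn : ∀ i j, 0 ≤ r i * a i j * (u i - u j) ^ 2 := fun i j =>
      mul_nonneg (mul_nonneg (hr i).le (ha i j)) (sq_nonneg _)
    have h1 : r l * a l k * (u l - u k) ^ 2 ≤ ∑ j, r l * a l j * (u l - u j) ^ 2 :=
      single_le_sum (f := fun j => r l * a l j * (u l - u j) ^ 2)
        (fun j _ => hnn l j) (mem_univ k)
    have h2 := single_le_sum (f := fun i => ∑ j, r i * a i j * (u i - u j) ^ 2)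
        (fun i _ => sum_nonneg fun j _ => hnn i j) (mem_univ l)
    rw [inv_mul_eq_div, le_div_iff₀ hp]
    calc (u k - u l) ^ 2 * (r l * a l k) = r l * a l k * (u l - u k) ^ 2 := by ring
      _ ≤ _ := h1.trans h2
  induction hij with
  | single h => exact step _ _ h
  | @tail k l _ h ih =>
    obtain ⟨c, hc, hcu⟩ := ih
    obtain ⟨d, hd, hdu⟩ := step _ _ h
    refine ⟨2 * (c + d), by positivity, fun u => ?_⟩
    have h1 := hcu u
    have h2 := hdu u
    nlinarith [sq_nonneg ((u i - u k) - (u k - u l))]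

/-- Poincaré inequality for the symmetrised Laplacian of a strongly connected digraph. -/
lemma exists_poincare {N : ℕ} {a : Fin N → Fin N → ℝ}
    (ha : ∀ i j, 0 ≤ a i j) (hsc : StronglyConnected a) {r : Fin N → ℝ}
    (hr : ∀ i, 0 < r i) (hr1 : ∑ i, r i = 1) (hrb : IsBalancing a r) :
    ∃ κ > (0 : ℝ), ∀ u : Fin N → ℝ,
      κ * ∑ i, r i * (u i - ∑ j, r j * u j) ^ 2 ≤ ∑ i, r i * (u i * lap a u i) := by
  have hpair : ∀ i j : Fin N, ∃ c : ℝ, 0 ≤ c ∧ ∀ u : Fin N → ℝ,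
      (u i - u j) ^ 2 ≤ c * ∑ k, ∑ l, r k * a k l * (u k - u l) ^ 2 := by
    intro i j
    by_cases hij : i = j
    · exact ⟨0, le_rfl, fun u => by simp [hij]⟩
    · exact exists_sq_sub_le_of_transGen ha hr (hsc i j hij)
  choose c hc hcu using hpair
  set S : ℝ := ∑ i, ∑ j, r i * r j * c i j with hSdef
  have hS : 0 ≤ S := sum_nonneg fun i _ => sum_nonneg fun j _ =>
    mul_nonneg (mul_nonneg (hr i).le (hr j).le) (hc i j)
  refine ⟨1 / (2 * (S + 1)), by positivity, fun u => ?_⟩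
  set E : ℝ := ∑ i, r i * (u i * lap a u i) with hE
  have hEE : 2 * E = ∑ k, ∑ l, r k * a k l * (u k - u l) ^ 2 := hrb.sum_mul_mul_lap u
  have hE0 : 0 ≤ 2 * E := hEE ▸ sum_nonneg fun i _ => sum_nonneg fun j _ =>
    mul_nonneg (mul_nonneg (hr i).le (ha i j)) (sq_nonneg _)
  have hjensen : ∀ i, (u i - ∑ j, r j * u j) ^ 2 ≤ ∑ j, r j * (u i - u j) ^ 2 := by
    intro i
    have hmean : u i - ∑ j, r j * u j = ∑ j, r j * (u i - u j) := by
      simp only [mul_sub, sum_sub_distrib, ← sum_mul, hr1, one_mul]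
    rw [hmean]
    simpa using (even_two.convexOn_pow (𝕜 := ℝ)).map_sum_le (t := univ) (w := r)
      (p := fun j => u i - u j) (fun j _ => (hr j).le) hr1 (fun j _ => Set.mem_univ _)
  have hmain : ∑ i, r i * (u i - ∑ j, r j * u j) ^ 2 ≤ S * (2 * E) := by
    rw [hSdef, sum_mul]
    refine sum_le_sum fun i _ => (mul_le_mul_of_nonneg_left (hjensen i) (hr i).le).trans ?_
    rw [mul_sum, sum_mul]
    refine sum_le_sum fun j _ => ?_
    have := mul_le_mul_of_nonneg_left (hcu i j u) (mul_nonneg (hr i).le (hr j).le)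
    rw [← hEE] at this
    linarith
  rw [one_div, inv_mul_eq_div, div_le_iff₀ (by positivity)]
  nlinarith

/-- `g` decays exponentially on `[0, ∞)`. -/
def ExpDecays (g : ℝ → ℝ) : Prop :=
  ∃ c > (0 : ℝ), ∃ lam > (0 : ℝ), ∀ t : ℝ, 0 ≤ t → |g t| ≤ c * Real.exp (-lam * t)

lemma ExpDecays.of_abs_le {g h : ℝ → ℝ} (hh : ExpDecays h)
    (hgh : ∀ t, 0 ≤ t → |g t| ≤ h t) : ExpDecays g := by
  obtain ⟨c, hc, l, hl, hb⟩ := hh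
  exact ⟨c, hc, l, hl, fun t ht => (hgh t ht).trans ((le_abs_self _).trans (hb t ht))⟩

lemma ExpDecays.zero : ExpDecays fun _ => 0 :=
  ⟨1, one_pos, 1, one_pos, fun t _ => by simpa using (Real.exp_pos _).le⟩

lemma ExpDecays.abs {g : ℝ → ℝ} (hg : ExpDecays g) : ExpDecays fun t => |g t| := by
  simpa only [ExpDecays, abs_abs] using hg

lemma ExpDecays.add {g h : ℝ → ℝ} (hg : ExpDecays g) (hh : ExpDecays h) :
    ExpDecays fun t => g t + h t := by
  obtain ⟨c, hc, l, hl, hb⟩ := hg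
  obtain ⟨d, hd, k, hk, hb'⟩ := hh
  refine ⟨c + d, by positivity, min l k, lt_min hl hk, fun t ht => ?_⟩
  have h1 : Real.exp (-l * t) ≤ Real.exp (-(min l k) * t) := by
    gcongr; exact min_le_left _ _
  have h2 : Real.exp (-k * t) ≤ Real.exp (-(min l k) * t) := by
    gcongr; exact min_le_right _ _
  calc |g t + h t| ≤ |g t| + |h t| := abs_add_le _ _
    _ ≤ c * Real.exp (-l * t) + d * Real.exp (-k * t) := add_le_add (hb t ht) (hb' t ht)
    _ ≤ c * Real.exp (-(min l k) * t) + d * Real.exp (-(min l k) * t) := by gcongr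
    _ = _ := by ring

lemma ExpDecays.const_mul {g : ℝ → ℝ} (hg : ExpDecays g) (b : ℝ) :
    ExpDecays fun t => b * g t := by
  obtain ⟨c, hc, l, hl, hb⟩ := hg
  refine ⟨(|b| + 1) * c, by positivity, l, hl, fun t ht => ?_⟩
  rw [abs_mul, mul_assoc]
  have := hb t ht
  gcongr
  linarith

lemma ExpDecays.sum {ι : Type*} (s : Finset ι) {g : ι → ℝ → ℝ} (hg : ∀ i, ExpDecays (g i)) :
    ExpDecays fun t => ∑ i ∈ s, g i t := by
  classical
  induction s using Finset.induction_on with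
  | empty => simpa using ExpDecays.zero
  | insert i s hi ih => simpa only [sum_insert hi] using (hg i).add ih

lemma ExpDecays.sq {g : ℝ → ℝ} (hg : ExpDecays g) : ExpDecays fun t => g t ^ 2 := by
  obtain ⟨c, hc, l, hl, hb⟩ := hg
  refine ⟨c ^ 2, by positivity, 2 * l, by positivity, fun t ht => ?_⟩
  have h := pow_le_pow_left₀ (abs_nonneg _) (hb t ht) 2
  rw [mul_pow, ← Real.exp_nat_mul] at h
  rw [abs_pow]
  refine h.trans_eq ?_
  congr 2
  push_cast
  ring

lemma ExpDecays.sqrt {g : ℝ → ℝ} (hg : ExpDecays g) : ExpDecays fun t => √(g t) := by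
  obtain ⟨c, hc, l, hl, hb⟩ := hg
  refine ⟨√c, by positivity, l / 2, by positivity, fun t ht => ?_⟩
  rw [abs_of_nonneg (Real.sqrt_nonneg _)]
  refine Real.sqrt_le_iff.2 ⟨by positivity, (le_abs_self _).trans ((hb t ht).trans_eq ?_)⟩
  rw [mul_pow, Real.sq_sqrt hc.le, ← Real.exp_nat_mul]
  congr 2
  push_cast
  ring

lemma le_initial_of_deriv_nonpos {G G' : ℝ → ℝ} (hG : ∀ t, 0 ≤ t → HasDerivAt G (G' t) t)
    (hG' : ∀ t, 0 ≤ t → G' t ≤ 0) {t : ℝ} (ht : 0 ≤ t) : G t ≤ G 0 := by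
  refine antitoneOn_of_hasDerivWithinAt_nonpos (convex_Ici 0) (f' := G')
    (fun s hs => (hG s hs).continuousAt.continuousWithinAt) ?_ ?_
    (Set.self_mem_Ici) ht ht
  · exact fun s hs => (hG s (interior_subset hs)).hasDerivWithinAt
  · exact fun s hs => hG' s (interior_subset hs)

lemma eq_initial_of_deriv_eq_zero {G : ℝ → ℝ} (hG : ∀ t, 0 ≤ t → HasDerivAt G 0 t)
    {t : ℝ} (ht : 0 ≤ t) : G t = G 0 := by
  refine le_antisymm (le_initial_of_deriv_nonpos hG (fun _ _ => le_rfl) ht) ?_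
  have := le_initial_of_deriv_nonpos (G := fun s => -G s) (fun s hs => (hG s hs).neg)
    (fun _ _ => neg_zero.le) ht
  linarith

/-- A Grönwall-type criterion: a nonnegative function whose linear decay is perturbed by
exponentially vanishing affine terms decays exponentially. -/
lemma expDecays_of_deriv_le {U U' g : ℝ → ℝ} {c : ℝ} (hc : 0 < c) (hg : ExpDecays g)
    (hU : ∀ t, 0 ≤ t → HasDerivAt U (U' t) t) (hU0 : ∀ t, 0 ≤ t → 0 ≤ U t)
    (hU' : ∀ t, 0 ≤ t → U' t ≤ -c * U t + g t * (1 + U t)) : ExpDecays U := by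
  obtain ⟨D, hD, l, hl, hgb⟩ := hg
  set μ := min l (c / 2) with hμdef
  have hμ : 0 < μ := lt_min hl (half_pos hc)
  have hμc : 0 < c - μ := by have : μ ≤ c / 2 := min_le_right _ _; linarith
  have hgμ : ∀ t, 0 ≤ t → g t ≤ D * Real.exp (-μ * t) := fun t ht => by
    refine (le_abs_self _).trans ((hgb t ht).trans ?_)
    gcongr
    exact min_le_left _ _
  set E : ℝ → ℝ := fun t => Real.exp (-μ * t) with hE
  set h : ℝ → ℝ := fun t => Real.exp (D / μ * E t) with hh
  set K := Real.exp (D / μ) with hK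
  have hexp : ∀ b t : ℝ, HasDerivAt (fun t => Real.exp (b * t)) (Real.exp (b * t) * b) t :=
    fun b t => by simpa using ((hasDerivAt_id t).const_mul b).exp
  have hEd : ∀ t, HasDerivAt E (E t * -μ) t := hexp (-μ)
  have hhd : ∀ t, HasDerivAt h (h t * (D / μ * (E t * -μ))) t := fun t =>
    ((hEd t).const_mul (D / μ)).exp
  have hE1 : ∀ t, 0 ≤ t → E t ≤ 1 := fun t ht => Real.exp_le_one_iff.2 (by nlinarith)
  have hh1 : ∀ t, 1 ≤ h t := fun t => Real.one_le_exp (by positivity)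
  have hhK : ∀ t, 0 ≤ t → h t ≤ K := fun t ht => by
    have := hE1 t ht
    refine Real.exp_le_exp.2 (mul_le_of_le_one_right (by positivity) this)
  have hsplit : ∀ t, Real.exp ((c - μ) * t) = Real.exp (c * t) * E t := fun t => by
    rw [hE, ← Real.exp_add]; congr 1; ring
  have key : ∀ t, 0 ≤ t → h t * U t * Real.exp (c * t)
      - D * K / (c - μ) * Real.exp ((c - μ) * t) ≤ K * U 0 := by
    intro t ht
    have hmono := le_initial_of_deriv_nonpos
      (G := fun t => h t * U t * Real.exp (c * t) - D * K / (c - μ) * Real.exp ((c - μ) * t))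
      (fun s hs => (((hhd s).mul (hU s hs)).mul (hexp c s)).sub
        ((hexp (c - μ) s).const_mul (D * K / (c - μ)))) ?_ ht
    · refine hmono.trans ?_
      have h0 : h 0 = K := by simp [hh, hE, hK]
      have : 0 ≤ D * K / (c - μ) := by positivity
      simpa [h0] using this
    · intro s hs
      have e1 : D / μ * (E s * -μ) = -(D * E s) := by field_simp
      have e2 : D * K / (c - μ) * (Real.exp ((c - μ) * s) * (c - μ))
          = D * K * (Real.exp (c * s) * E s) := by rw [hsplit]; field_simp
      simp only [Pi.mul_apply]
      rw [e1, e2]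
      have hUs := hU0 s hs
      have hEp : 0 < E s := Real.exp_pos _
      have i1 : U' s + c * U s - D * E s * U s ≤ D * E s := by
        have := mul_le_mul_of_nonneg_right (hgμ s hs) (by linarith : 0 ≤ 1 + U s)
        have := hU' s hs
        simp only [hE]
        linarith
      have i2 : h s * (U' s + c * U s - D * E s * U s) ≤ K * (D * E s) :=
        (mul_le_mul_of_nonneg_left i1 (by linarith [hh1 s])).trans
          (mul_le_mul_of_nonneg_right (hhK s hs) (by positivity))
      have i3 := mul_le_mul_of_nonneg_right i2 (Real.exp_pos (c * s)).le
      linarith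
  refine ⟨K * U 0 + D * K / (c - μ), ?_, μ, hμ, fun t ht => ?_⟩
  · have := hU0 0 le_rfl
    positivity
  have hk := key t ht
  rw [hsplit] at hk
  have hUt := hU0 t ht
  have hinv : Real.exp (-c * t) * Real.exp (c * t) = 1 := by
    rw [← Real.exp_add]; simp
  have hct : Real.exp (-c * t) ≤ E t := by
    simp only [hE]; gcongr; linarith
  have hU00 : 0 ≤ K * U 0 := mul_nonneg (Real.exp_pos _).le (hU0 0 le_rfl)
  rw [abs_of_nonneg hUt]
  calc U t ≤ h t * U t := le_mul_of_one_le_left hUt (hh1 t)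
    _ = (h t * U t * Real.exp (c * t)) * Real.exp (-c * t) := by
        rw [mul_assoc, mul_comm (Real.exp (c * t)), hinv, mul_one]
    _ ≤ (K * U 0 + D * K / (c - μ) * (Real.exp (c * t) * E t)) * Real.exp (-c * t) := by
        gcongr; linarith
    _ = K * U 0 * Real.exp (-c * t)
          + D * K / (c - μ) * E t * (Real.exp (-c * t) * Real.exp (c * t)) := by ring
    _ ≤ K * U 0 * E t + D * K / (c - μ) * E t * 1 := by rw [hinv]; gcongr
    _ = _ := by simp only [hE]; ring

lemma expDecays_norm_of_hasDerivAt {w g : ℝ → ℂ} {μ : ℂ} (hμ : μ.re < 0)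
    (hg : ExpDecays fun t => ‖g t‖)
    (hw : ∀ t, 0 ≤ t → HasDerivAt w (μ * w t + g t) t) : ExpDecays fun t => ‖w t‖ := by
  have hU : ExpDecays fun t => (w t).re * (w t).re + (w t).im * (w t).im := by
    have hre : ∀ t, 0 ≤ t → HasDerivAt (fun t => (w t).re) (μ * w t + g t).re t := fun t ht =>
      Complex.reCLM.hasFDerivAt.comp_hasDerivAt t (hw t ht)
    have him : ∀ t, 0 ≤ t → HasDerivAt (fun t => (w t).im) (μ * w t + g t).im t := fun t ht =>
      Complex.imCLM.hasFDerivAt.comp_hasDerivAt t (hw t ht)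
    refine expDecays_of_deriv_le (c := -μ.re) (by linarith) (hg.sq.const_mul (-μ.re)⁻¹)
      (fun t ht => ((hre t ht).mul (hre t ht)).add ((him t ht).mul (him t ht)))
      (fun t _ => add_nonneg (mul_self_nonneg _) (mul_self_nonneg _)) fun t _ => ?_
    have hk : 0 < -μ.re := by linarith
    have hgn : ‖g t‖ ^ 2 = (g t).re * (g t).re + (g t).im * (g t).im := by
      rw [← Complex.normSq_eq_norm_sq, Complex.normSq_apply]
    simp only [Complex.add_re, Complex.add_im, Complex.mul_re, Complex.mul_im, hgn]
    have hk0 : μ.re ≠ 0 := hμ.ne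
    have young : ∀ a p : ℝ, 2 * p * a ≤ -μ.re * a ^ 2 + (-μ.re)⁻¹ * p ^ 2 := fun a p => by
      have e : -μ.re * a ^ 2 + (-μ.re)⁻¹ * p ^ 2 - 2 * p * a
          = (-μ.re)⁻¹ * (-μ.re * a - p) ^ 2 := by field_simp; ring
      have : 0 ≤ (-μ.re)⁻¹ * (-μ.re * a - p) ^ 2 := by positivity
      linarith
    have hrest : 0 ≤ (-μ.re)⁻¹ * ((g t).re * (g t).re + (g t).im * (g t).im) *
        ((w t).re * (w t).re + (w t).im * (w t).im) :=
      mul_nonneg (mul_nonneg (by positivity)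
        (add_nonneg (mul_self_nonneg _) (mul_self_nonneg _)))
        (add_nonneg (mul_self_nonneg _) (mul_self_nonneg _))
    linarith [young (w t).re (g t).re, young (w t).im (g t).im]
  refine hU.sqrt.of_abs_le fun t _ => ?_
  rw [abs_of_nonneg (norm_nonneg _), ← Complex.normSq_apply, Complex.normSq_eq_norm_sq,
    Real.sqrt_sq (norm_nonneg _)]

lemma expDecays_of_aeval_mulVec_eq_zero {n : ℕ} (H : Matrix (Fin n) (Fin n) ℂ)
    (S : Multiset ℂ) (hS : ∀ μ ∈ S, μ.re < 0) (w : ℝ → Fin n → ℂ)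
    (hw : ∀ t, 0 ≤ t → HasDerivAt w (H *ᵥ w t) t)
    (h0 : ∀ t, 0 ≤ t → Polynomial.aeval H
      (S.map fun μ => Polynomial.X - Polynomial.C μ).prod *ᵥ w t = 0) (i : Fin n) :
    ExpDecays fun t => ‖w t i‖ := by
  induction S using Multiset.induction_on generalizing w i with
  | empty =>
    refine ExpDecays.zero.of_abs_le fun t ht => ?_
    have := h0 t ht
    simp only [Multiset.map_zero, Multiset.prod_zero, map_one, one_mulVec] at this
    simp [this]
  | cons μ S ih =>
    have hd : ∀ t, 0 ≤ t → HasDerivAt (fun t => H *ᵥ w t - μ • w t)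
        (H *ᵥ (H *ᵥ w t - μ • w t)) t := by
      intro t ht
      have h1 : HasDerivAt (fun t => H *ᵥ w t) (H *ᵥ (H *ᵥ w t)) t :=
        (LinearMap.toContinuousLinearMap
          ((Matrix.mulVecLin H).restrictScalars ℝ)).hasFDerivAt.comp_hasDerivAt t (hw t ht)
      rw [mulVec_sub, mulVec_smul]
      exact h1.sub ((hw t ht).const_smul μ)
    have hg := ih (fun ν hν => hS ν (Multiset.mem_cons_of_mem hν)) _ hd (fun t ht => by
      have := h0 t ht
      rw [Multiset.map_cons, Multiset.prod_cons, mul_comm, map_mul, ← mulVec_mulVec] at this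
      simpa [sub_mulVec, Algebra.algebraMap_eq_smul_one, smul_mulVec] using this)
    refine expDecays_norm_of_hasDerivAt (hS μ (Multiset.mem_cons_self μ S)) (hg i)
      fun t ht => ?_
    have := hasDerivAt_pi.1 (hw t ht) i
    simpa using this

/-- Solutions of a Hurwitz linear system decay exponentially. -/
lemma IsHurwitz.expDecays {n : ℕ} {H : Matrix (Fin n) (Fin n) ℝ} (hH : IsHurwitz H)
    {ξ : ℝ → Fin n → ℝ} (hξ : ∀ t, 0 ≤ t → HasDerivAt ξ (H *ᵥ ξ t) t) (i : Fin n) :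
    ExpDecays fun t => ξ t i := by
  set Hc : Matrix (Fin n) (Fin n) ℂ := H.map Complex.ofReal with hHc
  have hdec := expDecays_of_aeval_mulVec_eq_zero Hc Hc.charpoly.roots
    (fun μ hμ => hH μ (Polynomial.isRoot_of_mem_roots hμ)) (fun t k => (ξ t k : ℂ))
    (fun t ht => by
      refine hasDerivAt_pi.2 fun k => ?_
      have := (hasDerivAt_pi.1 (hξ t ht) k).ofReal_comp
      simpa [mulVec, dotProduct, hHc] using this)
    (fun t _ => by
      have h := (IsAlgClosed.splits Hc.charpoly).eq_prod_roots
      rw [(Matrix.charpoly_monic Hc).leadingCoeff, map_one, one_mul] at h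
      rw [← h, Matrix.aeval_self_charpoly, zero_mulVec]) i
  exact hdec.of_abs_le fun t _ => by simp

lemma grad_sum {N q : ℕ} {f : Fin N → (Fin q → ℝ) → ℝ} (hC1 : ∀ i, ContDiff ℝ 1 (f i))
    (x : Fin q → ℝ) (s : Fin q) :
    grad (fun y => ∑ j, f j y) x s = ∑ j, grad (f j) x s := by
  have h : HasFDerivAt (fun y => ∑ j, f j y) (∑ j, fderiv ℝ (f j) x) x :=
    HasFDerivAt.fun_sum fun j _ => ((hC1 j).differentiable (by simp) x).hasFDerivAt
  simp [grad, h.fderiv]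

lemma fderiv_apply_eq_sum_grad {q : ℕ} (f : (Fin q → ℝ) → ℝ) (x d : Fin q → ℝ) :
    fderiv ℝ f x d = ∑ s, d s * grad f x s := by
  conv_lhs => rw [pi_eq_sum_univ' d, map_sum]
  refine sum_congr rfl fun s _ => ?_
  rw [map_smul, smul_eq_mul, grad]

/-- Quadratic lower bound of a strongly convex differentiable function. -/
lemma StronglyConvexWith.lower_bound {q : ℕ} {m : ℝ} {f : (Fin q → ℝ) → ℝ}
    (hf : StronglyConvexWith m f) (hd : Differentiable ℝ f) (x : Fin q → ℝ) :
    f 0 + ∑ s, x s * grad f 0 s + m / 2 * ∑ s, x s ^ 2 ≤ f x := by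
  set b := ∑ s, x s * grad f 0 s
  set Q := ∑ s, x s ^ 2
  have hline : ∀ t : ℝ, HasDerivAt (fun t : ℝ => f (t • x)) (∑ s, x s * grad f (t • x) s) t := by
    intro t
    have h1 : HasDerivAt (fun t : ℝ => t • x) x t := by
      simpa using (hasDerivAt_id t).smul_const x
    rw [← fderiv_apply_eq_sum_grad]
    exact (hd (t • x)).hasFDerivAt.comp_hasDerivAt t h1
  have hpos : ∀ t : ℝ, 0 ≤ t → b + m * t * Q ≤ ∑ s, x s * grad f (t • x) s := by
    intro t ht
    rcases ht.eq_or_lt with rfl | ht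
    · simp [b]
    have h := hf (t • x) 0
    simp only [Pi.smul_apply, smul_eq_mul, Pi.zero_apply, sub_zero, mul_pow, mul_assoc,
      ← mul_sum, mul_sub, sum_sub_distrib] at h
    have h' : t * (m * t * Q) ≤ t * (∑ s, x s * grad f (t • x) s - b) := by
      simp only [b, Q]; linarith
    linarith [le_of_mul_le_mul_left h' ht]
  have hpoly : ∀ t : ℝ, HasDerivAt (fun t : ℝ => t * b + m / 2 * t ^ 2 * Q) (b + m * t * Q) t := by
    intro t
    have := ((hasDerivAt_id t).mul_const b).add
      (((hasDerivAt_pow 2 t).const_mul (m / 2)).mul_const Q)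
    refine this.congr_deriv ?_
    push_cast
    ring
  have := le_initial_of_deriv_nonpos
    (G := fun t => (t * b + m / 2 * t ^ 2 * Q) - f (t • x))
    (fun t _ => (hpoly t).sub (hline t)) (fun t ht => by linarith [hpos t ht]) zero_le_one
  simp at this
  linarith

lemma StronglyConvexWith.exists_forall_le {q : ℕ} {m : ℝ} (hm : 0 < m)
    {f : (Fin q → ℝ) → ℝ} (hf : StronglyConvexWith m f) (hd : Differentiable ℝ f) :
    ∃ x, ∀ y, f x ≤ f y := by
  refine hd.continuous.exists_forall_le ?_
  set G := ∑ s, grad f 0 s ^ 2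
  have hlow : ∀ x, f 0 - G / m + m / 4 * ‖x‖ ^ 2 ≤ f x := by
    intro x
    have h := hf.lower_bound hd x
    have hnorm : ‖x‖ ^ 2 ≤ ∑ s, x s ^ 2 := by
      have h1 : ‖x‖ ≤ √(∑ s, x s ^ 2) := by
        refine (pi_norm_le_iff_of_nonneg (Real.sqrt_nonneg _)).2 fun s => ?_
        refine Real.abs_le_sqrt ?_
        exact single_le_sum (f := fun s => x s ^ 2) (fun s _ => sq_nonneg _) (mem_univ s)
      calc ‖x‖ ^ 2 ≤ √(∑ s, x s ^ 2) ^ 2 := by gcongr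
        _ = _ := Real.sq_sqrt (sum_nonneg fun s _ => sq_nonneg _)
    have hyoung : -(G / m) - m / 4 * ∑ s, x s ^ 2 ≤ ∑ s, x s * grad f 0 s := by
      simp only [G, sum_div, mul_sum, ← sum_neg_distrib, ← sum_sub_distrib]
      refine sum_le_sum fun s _ => ?_
      have e : x s * grad f 0 s - (-(grad f 0 s ^ 2 / m) - m / 4 * x s ^ 2)
          = (m / 2 * x s + grad f 0 s) ^ 2 / m := by field_simp; ring
      have : 0 ≤ (m / 2 * x s + grad f 0 s) ^ 2 / m := by positivity
      linarith
    nlinarith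
  refine Filter.tendsto_atTop_mono hlow (Filter.tendsto_atTop_add_const_left _ _ ?_)
  exact ((Filter.tendsto_pow_atTop two_ne_zero).comp
    (tendsto_norm_cocompact_atTop)).const_mul_atTop (by positivity)

/-- A finite sum of strongly convex functions has a minimizer, at which the gradients add up
to zero. -/
lemma exists_minimizer_sum {N q : ℕ} (hN : 0 < N) {f : Fin N → (Fin q → ℝ) → ℝ}
    {m : Fin N → ℝ} (hm : ∀ i, 0 < m i) (hC1 : ∀ i, ContDiff ℝ 1 (f i))
    (hconv : ∀ i, StronglyConvexWith (m i) (f i)) :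
    ∃ x : Fin q → ℝ, (∀ y, ∑ j, f j x ≤ ∑ j, f j y) ∧ ∀ s, ∑ j, grad (f j) x s = 0 := by
  have hd : Differentiable ℝ fun y => ∑ j, f j y :=
    Differentiable.fun_sum fun j _ => (hC1 j).differentiable (by simp)
  have hsc : StronglyConvexWith (∑ j, m j) fun y => ∑ j, f j y := by
    intro x y
    simp only [grad_sum hC1, ← sum_sub_distrib, mul_sum (univ : Finset (Fin N))]
    rw [sum_mul, sum_comm (s := (univ : Finset (Fin q)))]
    exact sum_le_sum fun j _ => hconv j x y
  obtain ⟨x, hx⟩ := hsc.exists_forall_le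
    (sum_pos (fun i _ => hm i) ⟨⟨0, hN⟩, mem_univ _⟩) hd
  refine ⟨x, hx, fun s => ?_⟩
  rw [← grad_sum hC1, grad, IsLocalMin.fderiv_eq_zero (Filter.Eventually.of_forall hx)]
  rfl

lemma hasDerivAt_min_zero_sq (x : ℝ) :
    HasDerivAt (fun y : ℝ => min y 0 ^ 2) (2 * min x 0) x := by
  rcases lt_trichotomy x 0 with hx | rfl | hx
  · have h : HasDerivAt (fun y : ℝ => y ^ 2) (2 * min x 0) x := by
      simpa [min_eq_left hx.le] using hasDerivAt_pow 2 x
    refine h.congr_of_eventuallyEq ?_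
    filter_upwards [Iio_mem_nhds hx] with y hy
    rw [min_eq_left (Set.mem_Iio.1 hy).le]
  · rw [hasDerivAt_iff_isLittleO]
    have h : (fun y : ℝ => y ^ 2) =o[nhds 0] fun y : ℝ => y := by
      simpa using Asymptotics.isLittleO_pow_id (𝕜 := ℝ) (n := 2) one_lt_two
    simp only [min_self, mul_zero, smul_zero, sub_zero, ne_eq, OfNat.ofNat_ne_zero,
      not_false_eq_true, zero_pow]
    refine Asymptotics.IsBigO.trans_isLittleO (Asymptotics.IsBigO.of_norm_le fun y => ?_) h
    rw [Real.norm_eq_abs, abs_of_nonneg (sq_nonneg _)]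
    rcases le_total y 0 with hy | hy
    · rw [min_eq_left hy]
    · simpa [min_eq_right hy] using sq_nonneg y
  · have h : HasDerivAt (fun _ : ℝ => (0 : ℝ)) (2 * min x 0) x := by
      simpa [min_eq_right hx.le] using hasDerivAt_const x (0 : ℝ)
    refine h.congr_of_eventuallyEq ?_
    filter_upwards [Ioi_mem_nhds hx] with y hy
    simp [min_eq_right (Set.mem_Ioi.1 hy).le]

/-- `u` solves the Laplacian flow of `a` on `[0, ∞)`. -/
def IsLapFlow {N : ℕ} (a : Fin N → Fin N → ℝ) (u : Fin N → ℝ → ℝ) : Prop :=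
  ∀ i t, 0 ≤ t → HasDerivAt (u i) (-lap a (fun j => u j t) i) t

lemma IsLapFlow.nonneg {N : ℕ} {a : Fin N → Fin N → ℝ} (ha : ∀ i j, 0 ≤ a i j)
    {u : Fin N → ℝ → ℝ} (hu : IsLapFlow a u) (h0 : ∀ i, 0 ≤ u i 0) (i : Fin N) {t : ℝ}
    (ht : 0 ≤ t) : 0 ≤ u i t := by
  set φ : ℝ → ℝ := fun t => ∑ i, min (u i t) 0 ^ 2 with hφ
  set c : ℝ := 2 * ∑ i, ∑ j, a i j with hc
  have hφd : ∀ t, 0 ≤ t → HasDerivAt φ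
      (∑ i, 2 * min (u i t) 0 * -lap a (fun j => u j t) i) t := fun t ht =>
    HasDerivAt.fun_sum fun i _ => (hasDerivAt_min_zero_sq (u i t)).comp t (hu i t ht)
  have hφ' : ∀ t, ∑ i, 2 * min (u i t) 0 * -lap a (fun j => u j t) i ≤ c * φ t := by
    intro t
    rw [hc, mul_assoc, sum_mul, mul_sum]
    simp only [lap, sum_mul, mul_sum, ← sum_neg_distrib]
    refine sum_le_sum fun i _ => sum_le_sum fun j _ => ?_
    have hj : min (u j t) 0 ^ 2 ≤ φ t :=
      single_le_sum (f := fun j => min (u j t) 0 ^ 2) (fun k _ => sq_nonneg _) (mem_univ j)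
    have hmul : min (u i t) 0 * u i t = min (u i t) 0 ^ 2 := by
      rcases le_total (u i t) 0 with h | h
      · rw [min_eq_left h]; ring
      · rw [min_eq_right h]; ring
    have hcross : min (u i t) 0 * u j t ≤ min (u i t) 0 * min (u j t) 0 :=
      mul_le_mul_of_nonpos_left (min_le_left _ _) (min_le_right _ _)
    have hkey : min (u i t) 0 * -(u i t - u j t) ≤ φ t := by
      nlinarith [sq_nonneg (min (u i t) 0 - min (u j t) 0), sq_nonneg (min (u j t) 0),
        sq_nonneg (min (u i t) 0)]
    calc _ = 2 * (a i j * (min (u i t) 0 * -(u i t - u j t))) := by ring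
      _ ≤ 2 * (a i j * φ t) := by
        have := mul_le_mul_of_nonneg_left hkey (ha i j)
        linarith
  have hexp : ∀ t : ℝ, HasDerivAt (fun t => Real.exp (-c * t)) (Real.exp (-c * t) * -c) t :=
    fun t => by simpa using ((hasDerivAt_id t).const_mul (-c)).exp
  have hle := le_initial_of_deriv_nonpos (fun s hs => (hexp s).mul (hφd s hs)) (fun s _ => by
    have := mul_le_mul_of_nonneg_left (hφ' s) (Real.exp_pos (-c * s)).le
    linarith) ht
  have hφ0 : φ 0 = 0 := by simp [hφ, min_eq_right (h0 _)]
  simp only [Pi.mul_apply, hφ0, mul_zero] at hle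
  have hφt : φ t ≤ 0 := by
    by_contra! h
    exact absurd hle (not_le.2 (mul_pos (Real.exp_pos _) h))
  have hi : min (u i t) 0 ^ 2 ≤ φ t :=
    single_le_sum (f := fun j => min (u j t) 0 ^ 2) (fun k _ => sq_nonneg _) (mem_univ i)
  have : min (u i t) 0 = 0 := pow_eq_zero_iff two_ne_zero |>.1
    (le_antisymm (hi.trans hφt) (sq_nonneg _))
  exact min_eq_right_iff.1 this

lemma IsLapFlow.exp_le {N : ℕ} {a : Fin N → Fin N → ℝ} (ha : ∀ i j, 0 ≤ a i j)
    {u : Fin N → ℝ → ℝ} (hu : IsLapFlow a u) (h0 : ∀ i, 0 ≤ u i 0) (i : Fin N) {t : ℝ}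
    (ht : 0 ≤ t) : u i 0 * Real.exp (-(∑ j, a i j) * t) ≤ u i t := by
  set d := ∑ j, a i j with hd
  have hexp : ∀ t : ℝ, HasDerivAt (fun t => Real.exp (d * t)) (Real.exp (d * t) * d) t :=
    fun t => by simpa using ((hasDerivAt_id t).const_mul d).exp
  have hle := le_initial_of_deriv_nonpos
    (fun s hs => ((hexp s).mul (hu i s hs)).neg) (fun s hs => by
      have hlap : lap a (fun j => u j s) i ≤ d * u i s := by
        rw [lap, hd, sum_mul]
        exact sum_le_sum fun j _ => mul_le_mul_of_nonneg_left
          (sub_le_self _ (hu.nonneg ha h0 j hs)) (ha i j)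
      have := mul_le_mul_of_nonneg_left hlap (Real.exp_pos (d * s)).le
      linarith) ht
  simp only [Pi.neg_apply, Pi.mul_apply, mul_zero, Real.exp_zero, one_mul, neg_le_neg_iff] at hle
  calc u i 0 * Real.exp (-d * t) ≤ Real.exp (d * t) * u i t * Real.exp (-d * t) := by gcongr
    _ = u i t * (Real.exp (d * t) * Real.exp (-d * t)) := by ring
    _ = u i t := by rw [← Real.exp_add]; simp

lemma IsLapFlow.expDecays {N : ℕ} {a : Fin N → Fin N → ℝ} {r : Fin N → ℝ}
    (hr : ∀ i, 0 < r i) (hrb : IsBalancing a r) {κ : ℝ} (hκ : 0 < κ)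
    (hp : ∀ u : Fin N → ℝ,
      κ * ∑ i, r i * (u i - ∑ j, r j * u j) ^ 2 ≤ ∑ i, r i * (u i * lap a u i))
    {u : Fin N → ℝ → ℝ} (hu : IsLapFlow a u) (i : Fin N) :
    ExpDecays fun t => u i t - ∑ j, r j * u j 0 := by
  set b := ∑ j, r j * u j 0 with hb
  have hmean : ∀ t, 0 ≤ t → ∑ j, r j * u j t = b := fun t ht =>
    eq_initial_of_deriv_eq_zero (G := fun t => ∑ j, r j * u j t) (fun s hs => by
      have := HasDerivAt.fun_sum (u := univ) fun j _ => (hu j s hs).const_mul (r j)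
      simpa [hrb.sum_mul_lap] using this) ht
  have hV : ExpDecays fun t => ∑ i, r i * (u i t - b) ^ 2 := by
    refine expDecays_of_deriv_le (c := 2 * κ) (by positivity) ExpDecays.zero
      (fun t ht => HasDerivAt.fun_sum fun i _ =>
        (((hu i t ht).sub_const b).pow 2).const_mul (r i))
      (fun t _ => sum_nonneg fun i _ => mul_nonneg (hr i).le (sq_nonneg _)) fun t ht => ?_
    have h := hp fun j => u j t
    simp only [hmean t ht] at h
    have hsplit : ∑ i, r i * (((2 : ℕ) : ℝ) * (u i t - b) ^ (2 - 1) * -lap a (fun j => u j t) i)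
        = -2 * ∑ i, r i * (u i t * lap a (fun j => u j t) i)
          + 2 * b * ∑ i, r i * lap a (fun j => u j t) i := by
      rw [mul_sum, mul_sum, ← sum_add_distrib]
      exact sum_congr rfl fun i _ => by push_cast; ring
    rw [hsplit, hrb.sum_mul_lap]
    linarith
  refine (hV.const_mul (r i)⁻¹).sqrt.of_abs_le fun t _ => Real.abs_le_sqrt ?_
  rw [inv_mul_eq_div, le_div_iff₀ (hr i), mul_comm]
  exact single_le_sum (f := fun i => r i * (u i t - b) ^ 2)
    (fun k _ => mul_nonneg (hr k).le (sq_nonneg _)) (mem_univ i)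

lemma ExpDecays.inv_sub_inv {h : ℝ → ℝ} {r d : ℝ} (hr : 0 < r) (hd : 0 ≤ d)
    (hlow : ∀ t, 0 ≤ t → Real.exp (-d * t) ≤ h t) (hh : ExpDecays fun t => h t - r) :
    ExpDecays fun t => (h t)⁻¹ - r⁻¹ := by
  have hbound : ∃ b > 0, ∀ t, 0 ≤ t → b ≤ h t := by
    obtain ⟨c, hc, l, hl, hb⟩ := hh
    have hlim : Filter.Tendsto (fun t : ℝ => c * Real.exp (-l * t)) Filter.atTop (nhds 0) := by
      have h1 : Filter.Tendsto (fun t : ℝ => -l * t) Filter.atTop Filter.atBot :=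
        Filter.tendsto_id.const_mul_atTop_of_neg (neg_neg_of_pos hl)
      simpa using (Real.tendsto_exp_atBot.comp h1).const_mul c
    obtain ⟨T, hT⟩ := Filter.eventually_atTop.1 (hlim.eventually (gt_mem_nhds (half_pos hr)))
    refine ⟨min (r / 2) (Real.exp (-d * T)), lt_min (half_pos hr) (Real.exp_pos _),
      fun t ht => ?_⟩
    rcases le_total T t with hTt | hTt
    · have h1 := (abs_le.1 (hb t ht)).1
      have h2 := hT t hTt
      exact (min_le_left _ _).trans (by linarith)
    · refine (min_le_right _ _).trans (le_trans ?_ (hlow t ht))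
      exact Real.exp_le_exp.2 (by nlinarith)
  obtain ⟨b, hb, hbh⟩ := hbound
  refine (hh.abs.const_mul (b * r)⁻¹).of_abs_le fun t ht => ?_
  have hht : 0 < h t := hb.trans_le (hbh t ht)
  rw [_root_.inv_sub_inv hht.ne' hr.ne', abs_div, abs_of_pos (mul_pos hht hr), abs_sub_comm,
    inv_mul_eq_div]
  gcongr
  exact hbh t ht

/-- The nominal Lyapunov inequality for the saddle-type error dynamics with weights `r`. -/
lemma lyapunov_estimate {N q : ℕ} {a : Fin N → Fin N → ℝ} {r m M : Fin N → ℝ}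
    (hr : ∀ i, 0 < r i) (hr1 : ∀ i, r i ≤ 1) {κ γ₁ γ₂ c : ℝ} (hγ₂ : 0 < γ₂)
    (hp : ∀ u : Fin N → ℝ,
      κ * ∑ i, r i * (u i - ∑ j, r j * u j) ^ 2 ≤ ∑ i, r i * (u i * lap a u i))
    (hγ₁ : 0 ≤ γ₁) (hγ : γ₁ * κ = 4 * γ₂) (hMm : ∀ i, M i ^ 2 ≤ γ₂ * r i * m i)
    (hc : 0 ≤ c) (hcm : ∀ i, 3 / 2 * c ≤ m i) (hcγ : c ≤ γ₂ / 2)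
    {e η g : Fin N → Fin q → ℝ} (hη : ∀ s, ∑ i, r i * η i s = 0)
    (hmono : ∀ i, m i * ∑ s, e i s ^ 2 ≤ ∑ s, e i s * g i s)
    (hlip : ∀ i, ∑ s, g i s ^ 2 ≤ M i ^ 2 * ∑ s, e i s ^ 2) :
    ∑ i, ∑ s, (-(2 * e i s + η i s) * g i s - γ₁ * (r i * (e i s * lap a (fun j => e j s) i))
      - γ₂ * (r i * (2 * e i s * η i s + η i s ^ 2)))
      ≤ -c * ∑ i, ∑ s, r i * ((e i s ^ 2 + (e i s + η i s) ^ 2) / 2) := by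
  have hgrad : ∑ i, ∑ s, (-(2 * e i s + η i s) * g i s)
      ≤ ∑ i, ∑ s, (-(m i * e i s ^ 2) + γ₂ / 4 * (r i * η i s ^ 2)) := by
    refine sum_le_sum fun i _ => ?_
    have hk : 0 < γ₂ * r i := mul_pos hγ₂ (hr i)
    have hcross : ∑ s, -(η i s * g i s)
        ≤ ∑ s, (γ₂ / 4 * (r i * η i s ^ 2) + (γ₂ * r i)⁻¹ * g i s ^ 2) := by
      refine sum_le_sum fun s _ => ?_
      have e1 : γ₂ / 4 * (r i * η i s ^ 2) + (γ₂ * r i)⁻¹ * g i s ^ 2 - -(η i s * g i s)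
          = (γ₂ * r i)⁻¹ * (γ₂ * r i / 2 * η i s + g i s) ^ 2 := by
        have := (hr i).ne'
        field_simp
        ring
      have : 0 ≤ (γ₂ * r i)⁻¹ * (γ₂ * r i / 2 * η i s + g i s) ^ 2 := by positivity
      linarith
    have hg : (γ₂ * r i)⁻¹ * ∑ s, g i s ^ 2 ≤ m i * ∑ s, e i s ^ 2 := by
      rw [inv_mul_eq_div, div_le_iff₀ hk]
      have hE : 0 ≤ ∑ s, e i s ^ 2 := sum_nonneg fun s _ => sq_nonneg _
      have := mul_le_mul_of_nonneg_right (hMm i) hE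
      linarith [hlip i]
    have hs : ∑ s, (-(2 * e i s + η i s) * g i s)
        = -2 * ∑ s, e i s * g i s + ∑ s, -(η i s * g i s) := by
      rw [mul_sum, ← sum_add_distrib]
      exact sum_congr rfl fun s _ => by ring
    have hs' : ∑ s, (-(m i * e i s ^ 2) + γ₂ / 4 * (r i * η i s ^ 2))
        = -(m i * ∑ s, e i s ^ 2) + ∑ s, γ₂ / 4 * (r i * η i s ^ 2) := by
      rw [sum_add_distrib, sum_neg_distrib, mul_sum]
    rw [sum_add_distrib, ← mul_sum univ (fun s => g i s ^ 2)] at hcross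
    rw [hs, hs']
    linarith [hmono i]
  have hcons : ∑ i, ∑ s, (-γ₁ * (r i * (e i s * lap a (fun j => e j s) i))
      - 2 * γ₂ * (r i * (e i s * η i s))) ≤ ∑ i, ∑ s, γ₂ / 4 * (r i * η i s ^ 2) := by
    rw [sum_comm, sum_comm (f := fun i s => γ₂ / 4 * (r i * η i s ^ 2))]
    refine sum_le_sum fun s _ => ?_
    set b := ∑ j, r j * e j s with hb
    have h1 := mul_le_mul_of_nonneg_left (hp fun j => e j s) hγ₁
    rw [← mul_assoc, hγ, mul_sum] at h1
    have h2 : ∑ i, (-(2 * γ₂) * (r i * (e i s * η i s)))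
        ≤ ∑ i, (4 * γ₂ * (r i * (e i s - b) ^ 2) + γ₂ / 4 * (r i * η i s ^ 2)) := by
      have h3 : ∑ i, (-(2 * γ₂) * (r i * (e i s * η i s)))
          = ∑ i, (-(2 * γ₂) * (r i * ((e i s - b) * η i s))) := by
        have : ∑ i, (-(2 * γ₂) * (r i * ((e i s - b) * η i s)))
            = ∑ i, (-(2 * γ₂) * (r i * (e i s * η i s))) + 2 * γ₂ * b * ∑ i, r i * η i s := by
          rw [mul_sum, ← sum_add_distrib]
          exact sum_congr rfl fun i _ => by ring
        rw [this, hη s, mul_zero, add_zero]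
      rw [h3]
      refine sum_le_sum fun i _ => ?_
      have : 0 ≤ γ₂ * r i * (2 * (e i s - b) + η i s / 2) ^ 2 :=
        mul_nonneg (mul_nonneg hγ₂.le (hr i).le) (sq_nonneg _)
      linarith
    have h4 : ∑ i, (-γ₁ * (r i * (e i s * lap a (fun j => e j s) i))
          - 2 * γ₂ * (r i * (e i s * η i s)))
        = -(γ₁ * ∑ i, r i * (e i s * lap a (fun j => e j s) i))
          + ∑ i, (-(2 * γ₂) * (r i * (e i s * η i s))) := by
      rw [mul_sum, ← sum_neg_distrib, ← sum_add_distrib]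
      exact sum_congr rfl fun i _ => by ring
    rw [sum_add_distrib] at h2
    rw [h4]
    linarith
  have hfin : ∑ i, ∑ s, (-(m i * e i s ^ 2) + γ₂ / 4 * (r i * η i s ^ 2)
        + γ₂ / 4 * (r i * η i s ^ 2) - γ₂ * (r i * η i s ^ 2))
      ≤ -c * ∑ i, ∑ s, r i * ((e i s ^ 2 + (e i s + η i s) ^ 2) / 2) := by
    simp only [mul_sum]
    refine sum_le_sum fun i _ => sum_le_sum fun s _ => ?_
    have h1 : r i * ((e i s ^ 2 + (e i s + η i s) ^ 2) / 2)
        ≤ 3 / 2 * e i s ^ 2 + r i * η i s ^ 2 := by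
      nlinarith [mul_nonneg (hr i).le (sq_nonneg (e i s - η i s)),
        mul_nonneg (sub_nonneg.2 (hr1 i)) (sq_nonneg (e i s))]
    have h2 := mul_le_mul_of_nonneg_left h1 hc
    have h3 := mul_le_mul_of_nonneg_right (hcm i) (sq_nonneg (e i s))
    have h4 := mul_le_mul_of_nonneg_right hcγ (mul_nonneg (hr i).le (sq_nonneg (η i s)))
    linarith
  refine le_trans (le_of_eq ?_) (le_trans (add_le_add hgrad
    (add_le_add hcons (le_refl (-∑ i, ∑ s, γ₂ * (r i * η i s ^ 2))))) (le_trans (le_of_eq ?_) hfin))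
  · simp only [← sum_neg_distrib, ← sum_add_distrib]
    exact sum_congr rfl fun i _ => sum_congr rfl fun s _ => by ring
  · simp only [← sum_neg_distrib, ← sum_add_distrib]
    exact sum_congr rfl fun i _ => sum_congr rfl fun s _ => by ring

/-- Bound on the contribution of vanishing perturbations to the Lyapunov derivative. -/
lemma perturbation_estimate {N q : ℕ} {r M : Fin N → ℝ} (hr : ∀ i, 0 < r i) {L k : ℝ}
    (hL : ∀ i, M i ^ 2 ≤ L) (hL0 : 0 ≤ L) (hk : 0 ≤ k) {e η g δ : Fin N → Fin q → ℝ}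
    {g₀ : Fin N → Fin q → ℝ} (hlip : ∀ i, ∑ s, g i s ^ 2 ≤ M i ^ 2 * ∑ s, e i s ^ 2)
    (hδ : ∀ i s, |δ i s| ≤ k * (1 + |g i s| + |g₀ i s|)) :
    ∑ i, ∑ s, r i * ((2 * e i s + η i s) * δ i s)
      ≤ (∑ i, ∑ s, r i * (3 / 2 * (1 + g₀ i s ^ 2)) + 2 + 3 * L) * k
        * (1 + ∑ i, ∑ s, r i * ((e i s ^ 2 + (e i s + η i s) ^ 2) / 2)) := by
  set W := ∑ i, ∑ s, r i * ((e i s ^ 2 + (e i s + η i s) ^ 2) / 2) with hW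
  set G := ∑ i, ∑ s, r i * (3 / 2 * (1 + g₀ i s ^ 2)) with hG
  have hW0 : 0 ≤ W := sum_nonneg fun i _ => sum_nonneg fun s _ =>
    mul_nonneg (hr i).le (by positivity)
  have hG0 : 0 ≤ G := sum_nonneg fun i _ => sum_nonneg fun s _ =>
    mul_nonneg (hr i).le (by positivity)
  have hterm : ∀ i s, r i * ((2 * e i s + η i s) * δ i s)
      ≤ k * (r i * (e i s ^ 2 + (e i s + η i s) ^ 2) + 3 / 2 * (r i * g i s ^ 2)
        + r i * (3 / 2 * (1 + g₀ i s ^ 2))) := by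
    intro i s
    have h1 : (2 * e i s + η i s) * δ i s
        ≤ |2 * e i s + η i s| * (k * (1 + |g i s| + |g₀ i s|)) :=
      (le_abs_self _).trans (by
        rw [abs_mul]; exact mul_le_mul_of_nonneg_left (hδ i s) (abs_nonneg _))
    have h2 : |2 * e i s + η i s| * (1 + |g i s| + |g₀ i s|)
        ≤ e i s ^ 2 + (e i s + η i s) ^ 2 + 3 / 2 * g i s ^ 2 + 3 / 2 * (1 + g₀ i s ^ 2) := by
      have e1 : |2 * e i s + η i s| ^ 2 = (2 * e i s + η i s) ^ 2 := sq_abs _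
      have e2 : |g i s| ^ 2 = g i s ^ 2 := sq_abs _
      have e3 : |g₀ i s| ^ 2 = g₀ i s ^ 2 := sq_abs _
      nlinarith [sq_nonneg (|2 * e i s + η i s| - (1 + |g i s| + |g₀ i s|)),
        sq_nonneg (|g i s| - 1), sq_nonneg (|g₀ i s| - 1), sq_nonneg (|g i s| - |g₀ i s|),
        sq_nonneg (η i s)]
    have h3 := mul_le_mul_of_nonneg_left h2 hk
    have h4 : (2 * e i s + η i s) * δ i s ≤ k * (e i s ^ 2 + (e i s + η i s) ^ 2
        + 3 / 2 * g i s ^ 2 + 3 / 2 * (1 + g₀ i s ^ 2)) := by linarith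
    have h5 := mul_le_mul_of_nonneg_left h4 (hr i).le
    linarith
  have hg : ∑ i, ∑ s, 3 / 2 * (r i * g i s ^ 2) ≤ 3 * L * W := by
    rw [hW, mul_sum]
    refine sum_le_sum fun i _ => ?_
    have h1 := mul_le_mul_of_nonneg_left (hlip i) (hr i).le
    have hE : 0 ≤ ∑ s, e i s ^ 2 := sum_nonneg fun s _ => sq_nonneg _
    have h2 := mul_le_mul_of_nonneg_left (mul_le_mul_of_nonneg_right (hL i) hE) (hr i).le
    calc _ = 3 / 2 * (r i * ∑ s, g i s ^ 2) := by rw [mul_sum, mul_sum]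
      _ ≤ 3 / 2 * (r i * (L * ∑ s, e i s ^ 2)) := by linarith
      _ = ∑ s, 3 / 2 * (r i * (L * e i s ^ 2)) := by simp only [mul_sum]
      _ ≤ _ := by
        rw [mul_sum]
        refine sum_le_sum fun s _ => ?_
        have : 0 ≤ L * (r i * (e i s + η i s) ^ 2) :=
          mul_nonneg hL0 (mul_nonneg (hr i).le (sq_nonneg _))
        linarith
  have hsum : ∑ i, ∑ s, r i * ((2 * e i s + η i s) * δ i s)
      ≤ k * (2 * W + ∑ i, ∑ s, 3 / 2 * (r i * g i s ^ 2) + G) := by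
    refine (sum_le_sum fun i _ => sum_le_sum fun s _ => hterm i s).trans (le_of_eq ?_)
    simp only [hW, hG, mul_sum, ← sum_add_distrib]
    exact sum_congr rfl fun i _ => sum_congr rfl fun s _ => by ring
  refine hsum.trans ?_
  have h1 : 2 * W + ∑ i, ∑ s, 3 / 2 * (r i * g i s ^ 2) + G ≤ (G + 2 + 3 * L) * (1 + W) := by
    nlinarith [mul_nonneg hG0 hW0]
  have := mul_le_mul_of_nonneg_left h1 hk
  linarith

lemma hasDerivAt_mulVec {n k : ℕ} (P : Matrix (Fin k) (Fin n) ℝ) {x : ℝ → Fin n → ℝ}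
    {x' : Fin n → ℝ} {t : ℝ} (hx : HasDerivAt x x' t) :
    HasDerivAt (fun t => P *ᵥ x t) (P *ᵥ x') t :=
  (LinearMap.toContinuousLinearMap (Matrix.mulVecLin P)).hasFDerivAt.comp_hasDerivAt t hx

lemma lap_sub_const {N : ℕ} (a : Fin N → Fin N → ℝ) (u : Fin N → ℝ) (b : ℝ) (i : Fin N) :
    lap a (fun j => u j - b) i = lap a u i := by
  simp [lap]

/-- Exponential convergence of the outputs for perturbed gradient dynamics with consensus and
integral terms. -/
lemma output_expDecays {N q : ℕ} (hN : 0 < N) {a : Fin N → Fin N → ℝ} {r m M : Fin N → ℝ}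
    (hr : ∀ i, 0 < r i) (hr1 : ∀ i, r i ≤ 1) (hrb : IsBalancing a r) {κ γ₁ γ₂ : ℝ}
    (hp : ∀ u : Fin N → ℝ,
      κ * ∑ i, r i * (u i - ∑ j, r j * u j) ^ 2 ≤ ∑ i, r i * (u i * lap a u i))
    (hγ₂ : 0 < γ₂) (hγ₁ : 0 ≤ γ₁) (hγ : γ₁ * κ = 4 * γ₂) (hm : ∀ i, 0 < m i)
    (hMm : ∀ i, M i ^ 2 ≤ γ₂ * r i * m i) {f : Fin N → (Fin q → ℝ) → ℝ}
    (hconv : ∀ i, StronglyConvexWith (m i) (f i)) (hlip : ∀ i, GradLipschitzWith (M i) (f i))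
    {ystar : Fin q → ℝ} (hstar : ∀ s, ∑ j, grad (f j) ystar s = 0)
    {y v : Fin N → ℝ → Fin q → ℝ} {h : Fin N → ℝ → ℝ} {d : Fin N → Fin q → ℝ → ℝ}
    (hh : ∀ i, ExpDecays (h i)) (hd : ∀ i s, ExpDecays (d i s))
    (hy : ∀ i s t, 0 ≤ t → HasDerivAt (fun t => y i t s)
      (-((r i)⁻¹ + h i t) * grad (f i) (y i t) s - γ₁ * lap a (fun j => y j t s) i
        - γ₂ * v i t s + d i s t) t)
    (hv : ∀ i s t, 0 ≤ t → HasDerivAt (fun t => v i t s)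
      (γ₁ * lap a (fun j => y j t s) i) t)
    (hv0 : ∀ i, v i 0 = 0) (i : Fin N) (s : Fin q) :
    ExpDecays fun t => y i t s - ystar s := by
  obtain ⟨c, hc, hcm, hcγ⟩ : ∃ c > 0, (∀ i, 3 / 2 * c ≤ m i) ∧ c ≤ γ₂ / 2 := by
    have : Nonempty (Fin N) := ⟨⟨0, hN⟩⟩
    obtain ⟨k, hk⟩ := Finite.exists_min m
    refine ⟨min (2 / 3 * m k) (γ₂ / 2), lt_min (by linarith [hm k]) (by linarith), fun i => ?_,
      min_le_right _ _⟩
    linarith [hk i, min_le_left (2 / 3 * m k) (γ₂ / 2)]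
  set g₀ : Fin N → Fin q → ℝ := fun i s => grad (f i) ystar s with hg₀
  set e : ℝ → Fin N → Fin q → ℝ := fun t i s => y i t s - ystar s with he
  set η : ℝ → Fin N → Fin q → ℝ := fun t i s => v i t s + (γ₂ * r i)⁻¹ * g₀ i s with hη
  set g : ℝ → Fin N → Fin q → ℝ := fun t i s => grad (f i) (y i t) s - g₀ i s with hg
  set δ : ℝ → Fin N → Fin q → ℝ := fun t i s => d i s t - h i t * grad (f i) (y i t) s with hδ
  set k : ℝ → ℝ := fun t => ∑ i, ∑ s, |d i s t| + ∑ i, |h i t| with hkdef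
  set W : ℝ → ℝ := fun t => ∑ i, ∑ s, r i * ((e t i s ^ 2 + (e t i s + η t i s) ^ 2) / 2) with hW
  have hkdec : ExpDecays k :=
    (ExpDecays.sum univ fun i => ExpDecays.sum univ fun s => (hd i s).abs).add
      (ExpDecays.sum univ fun i => (hh i).abs)
  have hdk : ∀ t i s, |d i s t| ≤ k t := fun t i s =>
    calc |d i s t| ≤ ∑ s, |d i s t| :=
          single_le_sum (f := fun s => |d i s t|) (fun _ _ => abs_nonneg _) (mem_univ s)
      _ ≤ ∑ i, ∑ s, |d i s t| := single_le_sum (f := fun i => ∑ s, |d i s t|)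
          (fun _ _ => sum_nonneg fun _ _ => abs_nonneg _) (mem_univ i)
      _ ≤ k t := le_add_of_nonneg_right (sum_nonneg fun _ _ => abs_nonneg _)
  have hhk : ∀ t i, |h i t| ≤ k t := fun t i =>
    calc |h i t| ≤ ∑ i, |h i t| :=
          single_le_sum (f := fun i => |h i t|) (fun _ _ => abs_nonneg _) (mem_univ i)
      _ ≤ k t := le_add_of_nonneg_left
          (sum_nonneg fun _ _ => sum_nonneg fun _ _ => abs_nonneg _)
  have hk0 : ∀ t, 0 ≤ k t := fun t => add_nonneg
    (sum_nonneg fun _ _ => sum_nonneg fun _ _ => abs_nonneg _)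
    (sum_nonneg fun _ _ => abs_nonneg _)
  have hWd : ∀ t, 0 ≤ t → HasDerivAt W (∑ i, ∑ s,
      (-(2 * e t i s + η t i s) * g t i s - γ₁ * (r i * (e t i s * lap a (fun j => e t j s) i))
      - γ₂ * (r i * (2 * e t i s * η t i s + η t i s ^ 2)))
      + ∑ i, ∑ s, r i * ((2 * e t i s + η t i s) * δ t i s)) t := by
    intro t ht
    simp only [← sum_add_distrib]
    refine HasDerivAt.fun_sum fun i _ => HasDerivAt.fun_sum fun s _ => ?_
    have h1 := (hy i s t ht).sub_const (ystar s)
    have h2 := h1.add ((hv i s t ht).add_const ((γ₂ * r i)⁻¹ * g₀ i s))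
    refine ((((h1.pow 2).add (h2.pow 2)).div_const 2).const_mul (r i)).congr_deriv ?_
    simp only [he, lap_sub_const, hη, hg, hδ, Pi.add_apply]
    have := (hr i).ne'
    push_cast
    field_simp
    ring
  have hmean : ∀ t, 0 ≤ t → ∀ s, ∑ i, r i * η t i s = 0 := by
    intro t ht s
    have hconst := eq_initial_of_deriv_eq_zero (G := fun t => ∑ i, r i * v i t s) (fun τ hτ => by
      have := HasDerivAt.fun_sum (u := univ) fun i _ => (hv i s τ hτ).const_mul (r i)
      refine this.congr_deriv ?_
      rw [← mul_zero γ₁, ← hrb.sum_mul_lap fun j => y j τ s, mul_sum]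
      exact sum_congr rfl fun i _ => by ring) ht
    have e1 : ∑ i, r i * ((γ₂ * r i)⁻¹ * g₀ i s) = γ₂⁻¹ * ∑ i, g₀ i s := by
      rw [mul_sum]
      refine sum_congr rfl fun i _ => ?_
      have := (hr i).ne'
      field_simp
    simp only [hη, mul_add, sum_add_distrib]
    rw [hconst, e1, hg₀, hstar s]
    simp [hv0]
  have hWdec : ExpDecays W := by
    refine expDecays_of_deriv_le hc (hkdec.const_mul
        (∑ i, ∑ s, r i * (3 / 2 * (1 + g₀ i s ^ 2)) + 2 + 3 * ∑ i, M i ^ 2)) hWd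
      (fun t _ => sum_nonneg fun i _ => sum_nonneg fun s _ =>
        mul_nonneg (hr i).le (by positivity)) fun t ht => ?_
    refine add_le_add (lyapunov_estimate hr hr1 hγ₂ hp hγ₁ hγ hMm hc.le hcm hcγ (hmean t ht)
        (fun i => hconv i (y i t) ystar) fun i => hlip i (y i t) ystar)
      (perturbation_estimate hr (M := M)
        (fun i => single_le_sum (f := fun i => M i ^ 2) (fun _ _ => sq_nonneg _) (mem_univ i))
        (sum_nonneg fun _ _ => sq_nonneg _) (hk0 t) (fun i => hlip i (y i t) ystar)
        fun i s => ?_)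
    have hsplit : δ t i s = d i s t - h i t * (g t i s + g₀ i s) := by simp [hδ, hg]
    calc |δ t i s| ≤ |d i s t| + |h i t| * (|g t i s| + |g₀ i s|) := by
          rw [hsplit]
          refine (abs_sub _ _).trans ?_
          rw [abs_mul]
          gcongr
          exact abs_add_le _ _
      _ ≤ k t + k t * (|g t i s| + |g₀ i s|) := by
          gcongr
          · exact hdk t i s
          · exact hhk t i
      _ = _ := by ring
  refine (hWdec.const_mul (2 / r i)).sqrt.of_abs_le fun t _ => Real.abs_le_sqrt ?_
  have hnn : ∀ i s, 0 ≤ r i * ((e t i s ^ 2 + (e t i s + η t i s) ^ 2) / 2) := fun i s =>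
    mul_nonneg (hr i).le (by positivity)
  have hle : r i * ((e t i s ^ 2 + (e t i s + η t i s) ^ 2) / 2) ≤ W t :=
    (single_le_sum (f := fun s => r i * ((e t i s ^ 2 + (e t i s + η t i s) ^ 2) / 2))
      (fun s _ => hnn i s) (mem_univ s)).trans
    (single_le_sum (f := fun i => ∑ s, r i * ((e t i s ^ 2 + (e t i s + η t i s) ^ 2) / 2))
      (fun i _ => sum_nonneg fun s _ => hnn i s) (mem_univ i))
  have hsq : 0 ≤ r i * (e t i s + η t i s) ^ 2 := mul_nonneg (hr i).le (sq_nonneg _)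
  rw [div_mul_eq_mul_div, le_div_iff₀ (hr i)]
  change e t i s ^ 2 * r i ≤ _
  linarith

/-- The closed-loop vector field in terms of the shifted state `x - Ψ ρ`. -/
lemma closed_loop_eq {n p q : ℕ} {A : Matrix (Fin n) (Fin n) ℝ} {B : Matrix (Fin n) (Fin p) ℝ}
    (K : Matrix (Fin p) (Fin n) ℝ) {Ψ : Matrix (Fin n) (Fin q) ℝ}
    {Φ Υ : Matrix (Fin p) (Fin q) ℝ} (hΦ : B * Φ = A * Ψ) (hΥ : B * Υ = Ψ)
    (x : Fin n → ℝ) (ω ρ : Fin q → ℝ) :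
    A *ᵥ x + B *ᵥ (-(K *ᵥ x) + Υ *ᵥ ω - (Φ - K * Ψ) *ᵥ ρ)
      = (A - B * K) *ᵥ (x - Ψ *ᵥ ρ) + Ψ *ᵥ ω := by
  simp only [mulVec_add, mulVec_sub, sub_mulVec, mulVec_mulVec, mulVec_neg,
    Matrix.sub_mul, hΦ, hΥ, Matrix.mul_assoc]
  abel

/-- Theorem 1 of the paper: optimal output consensus via the distributed state
feedback controller (5) over a weight-unbalanced strongly connected digraph. -/
theorem optimal_output_consensus_state_feedback
    (N q : ℕ) (hN : 2 ≤ N) (a : Fin N → Fin N → ℝ)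
    (ha_nonneg : ∀ i j, 0 ≤ a i j) (ha_diag : ∀ i, a i i = 0)
    (hsc : StronglyConnected a)
    (n p : Fin N → ℕ)
    (A : (i : Fin N) → Matrix (Fin (n i)) (Fin (n i)) ℝ)
    (B : (i : Fin N) → Matrix (Fin (n i)) (Fin (p i)) ℝ)
    (C : (i : Fin N) → Matrix (Fin q) (Fin (n i)) ℝ)
    (K : (i : Fin N) → Matrix (Fin (p i)) (Fin (n i)) ℝ)
    (Ψ : (i : Fin N) → Matrix (Fin (n i)) (Fin q) ℝ)
    (Φ Υ : (i : Fin N) → Matrix (Fin (p i)) (Fin q) ℝ)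
    (hΨ : ∀ i, C i * Ψ i = 1)
    (hΦ : ∀ i, B i * Φ i = A i * Ψ i)
    (hΥ : ∀ i, B i * Υ i = Ψ i)
    (hK : ∀ i, IsHurwitz (A i - B i * K i))
    (f : Fin N → (Fin q → ℝ) → ℝ) (m M : Fin N → ℝ)
    (hm : ∀ i, 0 < m i) (hM : ∀ i, 0 < M i)
    (hC1 : ∀ i, ContDiff ℝ 1 (f i))
    (hconv : ∀ i, StronglyConvexWith (m i) (f i))
    (hlip : ∀ i, GradLipschitzWith (M i) (f i)) :
    ∃ γ₁ > (0 : ℝ), ∃ γ₂ > (0 : ℝ),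
      ∀ (x : (i : Fin N) → ℝ → Fin (n i) → ℝ)
        (ρ v : Fin N → ℝ → Fin q → ℝ)
        (z : Fin N → ℝ → Fin N → ℝ),
        -- initial conditions: v_i(0) = 0, z_i(0) = e_i
        (∀ i, v i 0 = 0) →
        (∀ i, z i 0 = Pi.single i 1) →
        -- closed-loop dynamics, writing `y_i = C_i x_i` and
        -- `ω_i = −∇f_i(y_i)/z_i^i − γ₁ Σ_j a_{ij}(y_i − y_j) − γ₂ v_i`
        (∀ i : Fin N, ∀ t : ℝ, 0 ≤ t →
          (HasDerivAt (x i)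
            ((A i).mulVec (x i t) +
              (B i).mulVec
                (-(K i).mulVec (x i t) +
                  (Υ i).mulVec (fun s =>
                    -(grad (f i) ((C i).mulVec (x i t)) s) / z i t i -
                      γ₁ * ∑ j, a i j * (((C i).mulVec (x i t)) s -
                        ((C j).mulVec (x j t)) s) -
                      γ₂ * v i t s) -
                  (Φ i - K i * Ψ i).mulVec (ρ i t))) t) ∧
          (HasDerivAt (ρ i)
            (fun s =>
              -(grad (f i) ((C i).mulVec (x i t)) s) / z i t i -
                γ₁ * ∑ j, a i j * (((C i).mulVec (x i t)) s -
                  ((C j).mulVec (x j t)) s) -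
                γ₂ * v i t s) t) ∧
          (HasDerivAt (v i)
            (fun s =>
              γ₁ * ∑ j, a i j * (((C i).mulVec (x i t)) s -
                ((C j).mulVec (x j t)) s)) t) ∧
          (HasDerivAt (z i)
            (fun k => -∑ j, a i j * (z i t k - z j t k)) t)) →
        -- conclusion: well-posedness of the controller and exponential
        -- convergence of every output to the unique global minimizer
        (∀ i : Fin N, ∀ t : ℝ, 0 ≤ t → 0 < z i t i) ∧
        ∃ ystar : Fin q → ℝ,
          (∀ y : Fin q → ℝ, ∑ j, f j ystar ≤ ∑ j, f j y) ∧
          ∃ c > (0 : ℝ), ∃ lam > (0 : ℝ),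
            ∀ i : Fin N, ∀ t : ℝ, 0 ≤ t →
              Real.sqrt (∑ s, (((C i).mulVec (x i t)) s - ystar s) ^ 2) ≤
                c * Real.exp (-lam * t) := by
  have hN0 : 0 < N := by omega
  obtain ⟨r, hr, hr_sum, hrb⟩ := exists_pos_isBalancing hN0 ha_nonneg hsc
  obtain ⟨κ, hκ, hp⟩ := exists_poincare ha_nonneg hsc hr hr_sum hrb
  have hr1 : ∀ i, r i ≤ 1 := fun i =>
    hr_sum ▸ single_le_sum (fun k _ => (hr k).le) (mem_univ i)
  obtain ⟨ystar, hmin, hstar⟩ := exists_minimizer_sum hN0 hm hC1 hconv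
  set γ₂ : ℝ := 1 + ∑ i, M i ^ 2 / (r i * m i) with hγ₂def
  have hnn : ∀ i, 0 ≤ M i ^ 2 / (r i * m i) := fun i =>
    div_nonneg (sq_nonneg _) (mul_pos (hr i) (hm i)).le
  have hγ₂ : 0 < γ₂ := add_pos_of_pos_of_nonneg one_pos (sum_nonneg fun i _ => hnn i)
  have hMm : ∀ i, M i ^ 2 ≤ γ₂ * r i * m i := fun i => by
    rw [mul_assoc, ← div_le_iff₀ (mul_pos (hr i) (hm i)), hγ₂def]
    have := single_le_sum (fun k _ => hnn k) (mem_univ i)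
    linarith
  refine ⟨4 * γ₂ / κ, by positivity, γ₂, hγ₂, fun x ρ v z hv0 hz0 hdyn => ?_⟩
  have hflow : ∀ k, IsLapFlow a fun i t => z i t k := fun k i t ht =>
    hasDerivAt_pi.1 (hdyn i t ht).2.2.2 k
  have hz0_nonneg : ∀ k i, 0 ≤ z i 0 k := fun k i => by
    rw [hz0 i, Pi.single_apply]
    split_ifs <;> simp
  have hzlow : ∀ k t, 0 ≤ t → Real.exp (-(∑ j, a k j) * t) ≤ z k t k := fun k t ht => by
    have := (hflow k).exp_le ha_nonneg (hz0_nonneg k) k ht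
    simpa [hz0] using this
  have hzdec : ∀ k, ExpDecays fun t => (z k t k)⁻¹ - (r k)⁻¹ := fun k => by
    refine ExpDecays.inv_sub_inv (hr k) (sum_nonneg fun j _ => ha_nonneg k j) (hzlow k) ?_
    simpa [hz0, Pi.single_apply] using (hflow k).expDecays hr hrb hκ hp k
  refine ⟨fun i t ht => (Real.exp_pos _).trans_le (hzlow i t ht), ystar, hmin, ?_⟩
  have hξ : ∀ i t, 0 ≤ t → HasDerivAt (fun t => x i t - Ψ i *ᵥ ρ i t)
      ((A i - B i * K i) *ᵥ (x i t - Ψ i *ᵥ ρ i t)) t := fun i t ht => by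
    have h := (hdyn i t ht).1.sub (hasDerivAt_mulVec (Ψ i) (hdyn i t ht).2.1)
    rw [closed_loop_eq (K i) (hΦ i) (hΥ i), add_sub_cancel_right] at h
    exact h
  have hd : ∀ i s, ExpDecays fun t =>
      (C i *ᵥ ((A i - B i * K i) *ᵥ (x i t - Ψ i *ᵥ ρ i t))) s := fun i s => by
    rw [funext fun t => congrFun (mulVec_mulVec _ (C i) (A i - B i * K i)) s]
    exact ExpDecays.sum univ fun l => ((hK i).expDecays (hξ i) l).const_mul _
  have hydec : ∀ i s, ExpDecays fun t => (C i *ᵥ x i t) s - ystar s := by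
    refine output_expDecays hN0 hr hr1 hrb hp hγ₂ (by positivity)
      (div_mul_cancel₀ _ hκ.ne') hm hMm hconv hlip hstar hzdec hd (fun i s t ht => ?_)
      (fun i s t ht => hasDerivAt_pi.1 (hdyn i t ht).2.2.1 s) hv0
    have h := hasDerivAt_mulVec (C i) (hdyn i t ht).1
    rw [closed_loop_eq (K i) (hΦ i) (hΥ i), mulVec_add, mulVec_mulVec _ (C i) (Ψ i), hΨ i,
      one_mulVec] at h
    refine (hasDerivAt_pi.1 h s).congr_deriv ?_
    simp only [Pi.add_apply, lap]
    ring
  obtain ⟨c, hc, lam, hlam, hb⟩ := ExpDecays.sum univ fun i =>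
    (ExpDecays.sum univ fun s => (hydec i s).sq).sqrt
  refine ⟨c, hc, lam, hlam, fun i t ht => le_trans ?_ ((le_abs_self _).trans (hb t ht))⟩
  exact single_le_sum (f := fun i => √(∑ s, ((C i *ᵥ x i t) s - ystar s) ^ 2))
    (fun _ _ => Real.sqrt_nonneg _) (mem_univ i)
end
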